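/- arXiv:2008.11543 — 13 statements merged into one kernel-verified Lean document; each statement's English description precedes it below -/
import Mathlib

section
/- Let T be a finite tree on n vertices. For every integer k, the limb numbers satisfy ℓ_k(T) = ℓ_{n−k}(T). -/
/-- The limb number `ℓ_k(T)`: the number of pairs `(v, T')` where `v` is a vertex of `T`
and `T'` is a connected component (given by its vertex set) with exactly `k` vertices
of the forest `T ∖ v` obtained by deleting `v` from `T`. -/
noncomputable def limbNumber {V : Type*} [Fintype V] (G : SimpleGraph V) (k : ℤ) : ℕ :=
  Set.ncard {p : V × Set V |
    (∃ c : (G.induce ({p.1}ᶜ : Set V)).ConnectedComponent, p.2 = Subtype.val '' c.supp)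
    ∧ (p.2.ncard : ℤ) = k}

namespace SimpleGraph

variable {V : Type*} {G : SimpleGraph V}

/-- The vertices reachable from `w` by walks in `G` that avoid `v`. -/
def branch (G : SimpleGraph V) (v w : V) : Set V :=
  {x | ∃ p : G.Walk w x, v ∉ p.support}

lemma mem_branch_iff_exists_path {v w x : V} :
    x ∈ G.branch v w ↔ ∃ p : G.Walk w x, p.IsPath ∧ v ∉ p.support := by
  classical
  constructor
  · rintro ⟨p, hp⟩
    exact ⟨p.bypass, p.bypass_isPath, fun h => hp (p.support_bypass_subset_support h)⟩
  · rintro ⟨p, -, hp⟩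
    exact ⟨p, hp⟩

lemma self_mem_branch {v w : V} (h : v ≠ w) : w ∈ G.branch v w :=
  ⟨Walk.nil, by simpa using h⟩

lemma image_supp_connectedComponentMk_eq_branch {v : V} (w : ({v}ᶜ : Set V)) :
    Subtype.val '' ((G.induce ({v}ᶜ : Set V)).connectedComponentMk w).supp = G.branch v w := by
  ext x
  constructor
  · rintro ⟨y, hy, rfl⟩
    rw [ConnectedComponent.mem_supp_iff, ConnectedComponent.eq] at hy
    obtain ⟨p⟩ := hy.symm
    refine ⟨p.map (Embedding.induce _).toHom, fun h => ?_⟩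
    erw [Walk.support_map, List.mem_map] at h
    obtain ⟨z, -, hz⟩ := h
    exact z.2 hz
  · rintro ⟨p, hp⟩
    have hs : ∀ z ∈ p.support, z ∈ ({v}ᶜ : Set V) := by
      rintro z hz rfl
      exact hp hz
    refine ⟨⟨x, hs x p.end_mem_support⟩, ?_, rfl⟩
    rw [ConnectedComponent.mem_supp_iff, ConnectedComponent.eq]
    exact (p.induce _ hs).reachable.symm

lemma Connected.exists_component_eq_iff_exists_branch_eq (hG : G.Connected) {v : V} {S : Set V} :
    (∃ c : (G.induce ({v}ᶜ : Set V)).ConnectedComponent, S = Subtype.val '' c.supp) ↔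
      ∃ w, G.Adj v w ∧ S = G.branch v w := by
  constructor
  · rintro ⟨c, rfl⟩
    induction c using ConnectedComponent.ind with | _ x =>
    obtain ⟨x, hxv⟩ := x
    obtain ⟨p, hp⟩ := hG.exists_isPath v x
    cases p with
    | nil => exact absurd rfl hxv
    | @cons _ w _ h q =>
      rw [Walk.cons_isPath_iff] at hp
      refine ⟨w, h, ?_⟩
      have hw : w ∈ ({v}ᶜ : Set V) := h.ne'
      rw [← image_supp_connectedComponentMk_eq_branch ⟨w, hw⟩]
      have hx : x ∈ G.branch v w := ⟨q, hp.2⟩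
      rw [← image_supp_connectedComponentMk_eq_branch ⟨w, hw⟩] at hx
      obtain ⟨y, hy, hyx⟩ := hx
      subst hyx
      rw [ConnectedComponent.mem_supp_iff] at hy
      rw [hy]
  · rintro ⟨w, h, rfl⟩
    exact ⟨_, (image_supp_connectedComponentMk_eq_branch ⟨w, h.ne'⟩).symm⟩

lemma IsTree.branch_swap (hG : G.IsTree) {v w : V} (h : G.Adj v w) :
    G.branch w v = (G.branch v w)ᶜ := by
  classical
  ext x
  constructor
  · intro hx hx'
    obtain ⟨q, hq, hwq⟩ := mem_branch_iff_exists_path.1 hx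
    obtain ⟨p, hp, hvp⟩ := mem_branch_iff_exists_path.1 hx'
    have := (hG.isAcyclic.subsingleton_path v x).elim ⟨q, hq⟩ ⟨Walk.cons h p, hp.cons hvp⟩
    rw [Subtype.mk.injEq] at this
    exact hwq (by simp [this])
  · intro hx
    obtain ⟨p, hp⟩ := hG.connected.exists_isPath w x
    have hv : v ∈ p.support := by
      by_contra hv
      exact hx ⟨p, hv⟩
    refine ⟨p.dropUntil v hv, fun hw => ?_⟩
    have hsupp := p.take_spec hv
    cases ht : p.takeUntil v hv with
    | nil => exact h.ne rfl
    | cons h' q =>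
      rw [ht] at hsupp
      rw [← hsupp, Walk.cons_append, Walk.cons_isPath_iff] at hp
      exact hp.2 ((Walk.mem_support_append_iff _ _).2 (Or.inr hw))

lemma IsAcyclic.eq_of_mem_branch (hG : G.IsAcyclic) {v w w' : V} (h : G.Adj v w)
    (h' : G.Adj v w') (hw : w' ∈ G.branch v w) : w = w' := by
  obtain ⟨p, hp, hvp⟩ := mem_branch_iff_exists_path.1 hw
  have := (hG.subsingleton_path v w').elim ⟨Walk.cons h p, hp.cons hvp⟩ (Path.singleton h')
  have hmem : w ∈ (Path.singleton h' : G.Walk v w').support := by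
    rw [← this]
    simp
  simpa [Path.singleton, h.ne'] using hmem

lemma IsAcyclic.branch_injective (hG : G.IsAcyclic) :
    Function.Injective fun d : G.Dart => (d.fst, G.branch d.fst d.snd) := by
  rintro ⟨⟨v, w⟩, h⟩ ⟨⟨v', w'⟩, h'⟩ he
  obtain ⟨rfl, hb⟩ : v = v' ∧ G.branch v w = G.branch v' w' := by simpa using he
  obtain rfl : w = w' := hG.eq_of_mem_branch h h' (hb ▸ self_mem_branch h'.ne)
  rfl

lemma IsTree.limbNumber_eq_ncard_darts [Fintype V] (hG : G.IsTree) (k : ℤ) :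
    limbNumber G k = {d : G.Dart | ((G.branch d.fst d.snd).ncard : ℤ) = k}.ncard := by
  rw [← Set.ncard_image_of_injective _ hG.isAcyclic.branch_injective, limbNumber]
  congr 1
  ext ⟨v, S⟩
  simp only [Set.mem_ofPred_eq, hG.connected.exists_component_eq_iff_exists_branch_eq,
    Set.mem_image, Prod.mk.injEq]
  constructor
  · rintro ⟨⟨w, h, rfl⟩, hk⟩
    exact ⟨⟨(v, w), h⟩, hk, rfl, rfl⟩
  · rintro ⟨d, hk, rfl, rfl⟩
    exact ⟨⟨d.snd, d.adj, rfl⟩, hk⟩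

lemma IsTree.ncard_branch_symm [Fintype V] (hG : G.IsTree) (d : G.Dart) :
    ((G.branch d.symm.fst d.symm.snd).ncard : ℤ) =
      Fintype.card V - (G.branch d.fst d.snd).ncard := by
  have h := Set.ncard_add_ncard_compl (G.branch d.fst d.snd)
  rw [← hG.branch_swap d.adj, Nat.card_eq_fintype_card] at h
  change ((G.branch d.snd d.fst).ncard : ℤ) = _
  omega

end SimpleGraph

theorem stmt_0 {V : Type*} [Fintype V] (G : SimpleGraph V) (hG : G.IsTree) (k : ℤ) :
    limbNumber G k = limbNumber G ((Fintype.card V : ℤ) - k) := by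
  rw [hG.limbNumber_eq_ncard_darts, hG.limbNumber_eq_ncard_darts,
    ← Set.ncard_image_of_injective _ SimpleGraph.Dart.symm_involutive.injective]
  congr 1
  ext d
  rw [SimpleGraph.Dart.symm_involutive.image_eq_preimage_symm]
  simp only [Set.mem_preimage, Set.mem_ofPred_eq, hG.ncard_branch_symm]
  omega
end

section
/- Let T be a finite tree such that ℓ_1(T) = 3, ℓ_2(T) = 3, and ℓ_3(T) = 0. Then T is isomorphic to the spider S_{2,2,2}, i.e., the 7-vertex tree consisting of a central vertex of degree 3 from which emanate three paths of two vertices each. -/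
/-- The spider `S_{2,2,2}`: the 7-vertex tree consisting of a central vertex `0` of degree 3
from which emanate three paths of two vertices each: `0 - 1 - 2`, `0 - 3 - 4`, `0 - 5 - 6`. -/
def spider222 : SimpleGraph (Fin 7) :=
  SimpleGraph.fromEdgeSet {s(0, 1), s(1, 2), s(0, 3), s(3, 4), s(0, 5), s(5, 6)}

namespace SimpleGraph

variable {V : Type*} {G : SimpleGraph V}

theorem Reachable.mem_of_adj_closed {S : Set V} (hS : ∀ a ∈ S, ∀ b, G.Adj a b → b ∈ S) {a b : V}
    (h : G.Reachable a b) (ha : a ∈ S) : b ∈ S := by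
  obtain ⟨p⟩ := h
  induction p with
  | nil => exact ha
  | cons hadj _ ih => exact ih (hS _ ha _ hadj)

/-- The pair `(v, S)` is a limb of `G`: `S` is the vertex set of a component of `G ∖ v`. -/
def IsLimb (G : SimpleGraph V) (v : V) (S : Set V) : Prop :=
  ∃ c : (G.induce ({v}ᶜ : Set V)).ConnectedComponent, S = Subtype.val '' c.supp

theorem IsLimb.of_reachable {v r : V} {S : Set V} (hv : v ∉ S) (hr : r ∈ S)
    (hclosed : ∀ a ∈ S, ∀ b, G.Adj a b → b = v ∨ b ∈ S)
    (hreach : ∀ a (ha : a ∈ S), (G.induce ({v}ᶜ : Set V)).Reachable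
      ⟨a, fun h => hv (h ▸ ha)⟩ ⟨r, fun h => hv (h ▸ hr)⟩) : G.IsLimb v S := by
  refine ⟨(G.induce ({v}ᶜ : Set V)).connectedComponentMk ⟨r, fun h => hv (h ▸ hr)⟩, ?_⟩
  ext a
  constructor
  · exact fun ha => ⟨⟨a, fun h => hv (h ▸ ha)⟩, ConnectedComponent.sound (hreach a ha), rfl⟩
  · rintro ⟨⟨a, hav⟩, ha, rfl⟩
    have h := (ConnectedComponent.exact ha).symm
    have hmem : ∀ x ∈ {x : ({v}ᶜ : Set V) | x.1 ∈ S}, ∀ y, (G.induce ({v}ᶜ : Set V)).Adj x y →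
        y ∈ {x : ({v}ᶜ : Set V) | x.1 ∈ S} :=
      fun x hx y hxy => (hclosed _ hx _ hxy).resolve_left y.2
    exact h.mem_of_adj_closed hmem hr

theorem IsLimb.notMem {v : V} {S : Set V} (h : G.IsLimb v S) : v ∉ S := by
  obtain ⟨c, rfl⟩ := h
  rintro ⟨a, -, ha⟩
  exact a.2 ha

theorem IsLimb.eq_or_mem_of_adj {v a b : V} {S : Set V} (h : G.IsLimb v S) (ha : a ∈ S)
    (hab : G.Adj a b) : b = v ∨ b ∈ S := by
  obtain ⟨c, rfl⟩ := h
  obtain ⟨a, hac, rfl⟩ := ha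
  by_cases hb : b = v
  · exact .inl hb
  · exact .inr ⟨⟨b, hb⟩, c.mem_supp_of_adj_mem_supp hac hab, rfl⟩

theorem IsLimb.subset_of_adj_closed {v a : V} {S A : Set V} (h : G.IsLimb v S) (haS : a ∈ S)
    (haA : a ∈ A) (hA : ∀ x ∈ A, ∀ y, y ≠ v → G.Adj x y → y ∈ A) : S ⊆ A := by
  obtain ⟨c, rfl⟩ := h
  obtain ⟨a, hac, rfl⟩ := haS
  rintro _ ⟨b, hb, rfl⟩
  have h : (G.induce ({v}ᶜ : Set V)).Reachable a b :=
    ConnectedComponent.exact (Eq.trans hac (Eq.symm hb))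
  have hmem : ∀ x ∈ {x : ({v}ᶜ : Set V) | x.1 ∈ A}, ∀ y, (G.induce ({v}ᶜ : Set V)).Adj x y →
      y ∈ {x : ({v}ᶜ : Set V) | x.1 ∈ A} := fun x hx y hxy => hA _ hx _ y.2 hxy
  exact h.mem_of_adj_closed hmem haA

theorem IsAcyclic.not_adj_of_adj_adj (hG : G.IsAcyclic) {a b c : V} (hab : G.Adj a b)
    (hbc : G.Adj b c) : ¬ G.Adj a c := by
  intro hac
  have h := (hG.subsingleton_path a c).elim (Path.singleton hac)
    ⟨.cons hab (.cons hbc .nil), by simp [hab.ne, hbc.ne, hac.ne]⟩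
  have := congrArg (fun p : G.Path a c => p.1.length) h
  simp [Path.singleton] at this

/-- `x` has exactly one neighbour. -/
def IsLeaf (G : SimpleGraph V) (x : V) : Prop := ∃ u, ∀ w, G.Adj x w ↔ w = u

/-- `x` is a leaf whose only neighbour `u` has `v` and `x` as its only neighbours. -/
structure IsTail (G : SimpleGraph V) (v u x : V) : Prop where
  adj_mid : ∀ w, G.Adj u w ↔ w = v ∨ w = x
  adj_leaf : ∀ w, G.Adj x w ↔ w = u
  ne : v ≠ x

theorem IsLimb.exists_isTail (hG : G.IsTree) {v : V} {S : Set V} (h : G.IsLimb v S)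
    (hS : S.ncard = 2) : ∃ u x, S = {u, x} ∧ G.IsTail v u x := by
  obtain ⟨a, b, hne, rfl⟩ := Set.ncard_eq_two.1 hS
  have hv := h.notMem
  simp only [Set.mem_insert_iff, Set.mem_singleton_iff, not_or] at hv
  have hab : G.Adj a b := by
    by_contra hab
    have := h.subset_of_adj_closed (a := a) (A := {a}) (by simp) rfl (by
      rintro x rfl y hy hxy
      rcases h.eq_or_mem_of_adj (by simp) hxy with h1 | h1 | h1
      · exact (hy h1).elim
      · exact h1
      · exact (hab (h1 ▸ hxy)).elim)
    exact hne (this (by simp : b ∈ ({a, b} : Set V))).symm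
  have hor : G.Adj a v ∨ G.Adj b v := by
    by_contra hc
    push Not at hc
    have := (hG.connected.preconnected a v).mem_of_adj_closed (S := {a, b}) (by
      intro x hx y hxy
      rcases h.eq_or_mem_of_adj hx hxy with rfl | h1
      · rcases hx with rfl | rfl
        · exact (hc.1 hxy).elim
        · exact (hc.2 hxy).elim
      · exact h1) (by simp)
    exact h.notMem this
  have key : ∀ u x : V, ({a, b} : Set V) = {u, x} → v ≠ x → G.Adj u x → G.Adj u v →
      G.IsTail v u x := by
    intro u x hs hvx hux huv
    rw [hs] at h
    have hxv : ¬ G.Adj x v := hG.isAcyclic.not_adj_of_adj_adj hux.symm huv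
    refine ⟨fun w => ⟨fun hw => ?_, ?_⟩, fun w => ⟨fun hw => ?_, ?_⟩, hvx⟩
    · rcases h.eq_or_mem_of_adj (by simp) hw with h1 | h1 | h1
      · exact .inl h1
      · exact (hw.ne h1.symm).elim
      · exact .inr h1
    · rintro (rfl | rfl) <;> assumption
    · rcases h.eq_or_mem_of_adj (by simp) hw with h1 | h1 | h1
      · exact (hxv (h1 ▸ hw)).elim
      · exact h1
      · exact (hw.ne h1.symm).elim
    · rintro rfl
      exact hux.symm
  rcases hor with h1 | h1
  · exact ⟨a, b, rfl, key a b rfl hv.2 hab h1⟩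
  · exact ⟨b, a, Set.pair_comm a b, key b a (Set.pair_comm a b) hv.1 hab.symm h1⟩

theorem isLimb_singleton {u x : V} (hx : ∀ w, G.Adj x w ↔ w = u) : G.IsLimb u {x} := by
  have hux : G.Adj x u := (hx u).2 rfl
  refine IsLimb.of_reachable (r := x) hux.ne' rfl ?_ ?_
  · rintro a rfl b hb
    exact .inl ((hx b).1 hb)
  · rintro a rfl
    exact .rfl

namespace IsTail

variable {v u x : V}

theorem adj_mid_left (h : G.IsTail v u x) : G.Adj u v := (h.adj_mid v).2 (.inl rfl)

theorem adj_mid_right (h : G.IsTail v u x) : G.Adj u x := (h.adj_mid x).2 (.inr rfl)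

theorem not_leaf_mid (h : G.IsTail v u x) : ¬ G.IsLeaf u := by
  rintro ⟨y, hy⟩
  exact h.ne (((hy v).1 h.adj_mid_left).trans ((hy x).1 h.adj_mid_right).symm)

theorem isLimb_triple (h : G.IsTail v u x) {y : V} (hyu : y ≠ u)
    (hv : ∀ w, G.Adj v w ↔ w = u ∨ w = y) : G.IsLimb y {v, u, x} := by
  have hvy : G.Adj v y := (hv y).2 (.inr rfl)
  have hyx : y ≠ x := by
    rintro rfl
    exact h.adj_mid_left.ne' ((h.adj_leaf v).1 hvy.symm)
  refine IsLimb.of_reachable (r := u) ?_ (by simp) ?_ ?_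
  · simp [hyu, hyx, hvy.ne']
  · rintro a (rfl | rfl | rfl) b hb
    · rcases (hv b).1 hb with rfl | rfl <;> simp
    · rcases (h.adj_mid b).1 hb with rfl | rfl <;> simp
    · rw [(h.adj_leaf b).1 hb]; simp
  · rintro a (rfl | rfl | rfl)
    · exact Adj.reachable (G := G.induce _) h.adj_mid_left.symm
    · exact .rfl
    · exact Adj.reachable (G := G.induce _) h.adj_mid_right.symm

theorem ncard_triple (h : G.IsTail v u x) : ({v, u, x} : Set V).ncard = 3 :=
  Set.ncard_eq_three.2 ⟨v, u, x, h.adj_mid_left.ne', h.ne, h.adj_mid_right.ne, rfl⟩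

theorem univ_of_leaf (hG : G.Connected) (h : G.IsTail v u x) (hv : G.IsLeaf v)
    (w : V) : w = v ∨ w = u ∨ w = x := by
  obtain ⟨y, hy⟩ := hv
  obtain rfl := (hy u).1 h.adj_mid_left.symm
  refine (hG.preconnected v w).mem_of_adj_closed (S := {v, u, x}) ?_ (by simp)
  rintro a (rfl | rfl | rfl) b hb
  · simp [(hy b).1 hb]
  · rcases (h.adj_mid b).1 hb with rfl | rfl <;> simp
  · simp [(h.adj_leaf b).1 hb]

theorem not_leaf_end (hG : G.Connected) (h : G.IsTail v u x) {a b c : V}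
    (hab : a ≠ b) (hac : a ≠ c) (hbc : b ≠ c)
    (ha : G.IsLeaf a) (hb : G.IsLeaf b) (hc : G.IsLeaf c) : ¬ G.IsLeaf v := by
  intro hv
  have hu := h.not_leaf_mid
  have key : ∀ w, G.IsLeaf w → w = v ∨ w = x := by
    intro w hw
    rcases h.univ_of_leaf hG hv w with h1 | rfl | h1
    · exact .inl h1
    · exact (hu hw).elim
    · exact .inr h1
  have := key a ha
  have := key b hb
  have := key c hc
  grind

theorem three_le_degree [Fintype V] [DecidableRel G.Adj] (h : G.IsTail v u x)
    (hv : ¬ G.IsLeaf v) (h3 : ∀ y S, G.IsLimb y S → S.ncard ≠ 3) : 3 ≤ G.degree v := by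
  classical
  by_contra hlt
  have hadj := h.adj_mid_left.symm
  have hpos : 0 < G.degree v := (G.degree_pos_iff_exists_adj v).2 ⟨u, hadj⟩
  obtain hd | hd : G.degree v = 1 ∨ G.degree v = 2 := by omega
  · obtain ⟨y, hy⟩ := Finset.card_eq_one.1 hd
    exact hv ⟨y, fun w => by rw [← mem_neighborFinset, hy, Finset.mem_singleton]⟩
  · have hu : u ∈ G.neighborFinset v := (mem_neighborFinset _ _ _).2 hadj
    obtain ⟨y, hy⟩ := Finset.card_eq_one.1
      (by rw [Finset.card_erase_of_mem hu, card_neighborFinset_eq_degree, hd] :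
        ((G.neighborFinset v).erase u).card = 1)
    have hyu : y ≠ u := Finset.ne_of_mem_erase (hy ▸ Finset.mem_singleton_self y)
    refine h3 y _ (h.isLimb_triple hyu fun w => ?_) h.ncard_triple
    have := congrArg (w ∈ ·) hy
    simp only [Finset.mem_erase, mem_neighborFinset, Finset.mem_singleton, eq_iff_iff] at this
    grind

end IsTail

theorem IsTree.sum_degree_sub_two [Fintype V] [DecidableRel G.Adj] (hG : G.IsTree) :
    ∑ w, ((G.degree w : ℤ) - 2) = -2 := by
  classical
  have h1 := G.sum_degrees_eq_twice_card_edges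
  have h2 := hG.card_edgeFinset
  rw [Finset.sum_sub_distrib, ← Nat.cast_sum, h1]
  simp only [Finset.sum_const, Finset.card_univ, nsmul_eq_mul]
  rw [← h2]
  push_cast
  ring

theorem nonempty_iso_spider222 (hG : G.Connected) {v u₁ x₁ u₂ x₂ u₃ x₃ : V}
    (hv : ∀ w, G.Adj v w ↔ w = u₁ ∨ w = u₂ ∨ w = u₃)
    (h₁ : G.IsTail v u₁ x₁) (h₂ : G.IsTail v u₂ x₂) (h₃ : G.IsTail v u₃ x₃)
    (hinj : Function.Injective ![v, u₁, x₁, u₂, x₂, u₃, x₃]) : Nonempty (G ≃g spider222) := by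
  have hsurj : Function.Surjective ![v, u₁, x₁, u₂, x₂, u₃, x₃] := by
    intro w
    refine (hG.preconnected v w).mem_of_adj_closed
      (S := Set.range ![v, u₁, x₁, u₂, x₂, u₃, x₃]) ?_ ⟨0, rfl⟩
    rintro _ ⟨i, rfl⟩ b hb
    simp only [Matrix.range_cons, Matrix.range_empty, Set.union_empty, Set.mem_union,
      Set.mem_singleton_iff]
    fin_cases i <;>
      simp [hv, h₁.adj_mid, h₁.adj_leaf, h₂.adj_mid, h₂.adj_leaf, h₃.adj_mid, h₃.adj_leaf] at hb <;>
      tauto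
  have hbij : Function.Bijective ![v, u₁, x₁, u₂, x₂, u₃, x₃] := ⟨hinj, hsurj⟩
  refine ⟨RelIso.symm ⟨Equiv.ofBijective _ hbij, ?_⟩⟩
  have hne : ∀ i j, ![v, u₁, x₁, u₂, x₂, u₃, x₃] i = ![v, u₁, x₁, u₂, x₂, u₃, x₃] j ↔ i = j :=
    fun i j => hinj.eq_iff
  have hnbr : ∀ i w, G.Adj (![v, u₁, x₁, u₂, x₂, u₃, x₃] i) w ↔
      ∃ j, spider222.Adj i j ∧ w = ![v, u₁, x₁, u₂, x₂, u₃, x₃] j := by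
    intro i w
    fin_cases i <;>
      simp [spider222, Fin.exists_fin_succ, hv, h₁.adj_mid, h₁.adj_leaf, h₂.adj_mid, h₂.adj_leaf,
        h₃.adj_mid, h₃.adj_leaf]
  intro i j
  simp only [Equiv.ofBijective_apply, hnbr, hne]
  exact ⟨fun ⟨_, h, e⟩ => e ▸ h, fun h => ⟨j, h, rfl⟩⟩

theorem nonempty_iso_spider222_of_isTail [Fintype V] (hG : G.IsTree)
    {v₁ v₂ v₃ u₁ x₁ u₂ x₂ u₃ x₃ : V}
    (h₁ : G.IsTail v₁ u₁ x₁) (h₂ : G.IsTail v₂ u₂ x₂) (h₃ : G.IsTail v₃ u₃ x₃)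
    (h12 : x₁ ≠ x₂) (h13 : x₁ ≠ x₃) (h23 : x₂ ≠ x₃)
    (hleaf : ∀ w, G.IsLeaf w → w = x₁ ∨ w = x₂ ∨ w = x₃)
    (h3 : ∀ y S, G.IsLimb y S → S.ncard ≠ 3) : Nonempty (G ≃g spider222) := by
  classical
  have l₁ : G.IsLeaf x₁ := ⟨_, h₁.adj_leaf⟩
  have l₂ : G.IsLeaf x₂ := ⟨_, h₂.adj_leaf⟩
  have l₃ : G.IsLeaf x₃ := ⟨_, h₃.adj_leaf⟩
  have hend : ∀ {v u x}, G.IsTail v u x → ¬ G.IsLeaf v :=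
    fun h => h.not_leaf_end hG.connected h12 h13 h23 l₁ l₂ l₃
  have hdeg : ∀ {v u x}, G.IsTail v u x → 3 ≤ G.degree v :=
    fun h => h.three_le_degree (hend h) h3
  have hvx : ∀ {v u x x'}, G.IsTail v u x → G.IsLeaf x' → v ≠ x' := by
    rintro v u x x' h hl rfl
    exact hend h hl
  have hux : ∀ {v u x x'}, G.IsTail v u x → G.IsLeaf x' → u ≠ x' := by
    rintro v u x x' h hl rfl
    exact h.not_leaf_mid hl
  have hu : ∀ {v u x v' u' x'}, G.IsTail v u x → G.IsTail v' u' x' → x ≠ x' → u ≠ u' := by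
    rintro v u x v' u' x' h h' hx rfl
    rcases (h.adj_mid x').1 h'.adj_mid_right with h1 | h1
    · exact hvx h ⟨_, h'.adj_leaf⟩ h1.symm
    · exact hx h1.symm
  have hpos : ∀ w, 1 ≤ G.degree w := by
    have : Nontrivial V := ⟨x₁, x₂, h12⟩
    exact fun w => hG.connected.preconnected.degree_pos_of_nontrivial w
  have hother : ∀ w, w ≠ x₁ → w ≠ x₂ → w ≠ x₃ → 2 ≤ G.degree w := by
    intro w w1 w2 w3
    by_contra hlt
    have := hpos w
    obtain ⟨y, hy⟩ := Finset.card_eq_one.1 (by omega : G.degree w = 1)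
    have := hleaf w ⟨y, fun w => by rw [← mem_neighborFinset, hy, Finset.mem_singleton]⟩
    tauto
  have hsum := hG.sum_degree_sub_two
  have hbound : ∀ a b : V, (∀ w, (if w = a then 1 else 0) + (if w = b then 1 else 0) -
      (if w = x₁ then 1 else 0) - (if w = x₂ then 1 else 0) - (if w = x₃ then 1 else 0) ≤
      (G.degree w : ℤ) - 2) → False := by
    intro a b hab
    have := Finset.sum_le_sum fun w (_ : w ∈ Finset.univ) => hab w
    simp [Finset.sum_sub_distrib, Finset.sum_add_distrib] at this hsum
    omega
  have heq : ∀ {v u x v' u' x'}, G.IsTail v u x → G.IsTail v' u' x' → v = v' := by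
    intro v u x v' u' x' h h'
    by_contra hne
    refine hbound v v' fun w => ?_
    have := hdeg h
    have := hdeg h'
    have := hother w
    have := hpos w
    have := hvx h l₁
    have := hvx h l₂
    have := hvx h l₃
    have := hvx h' l₁
    have := hvx h' l₂
    have := hvx h' l₃
    grind
  obtain rfl := heq h₁ h₂
  obtain rfl := heq h₁ h₃
  have hd : G.degree v₁ ≤ 3 := by
    by_contra hd
    refine hbound v₁ v₁ fun w => ?_
    have := hother w
    have := hpos w
    have := hvx h₁ l₁
    have := hvx h₁ l₂
    have := hvx h₁ l₃
    grind
  have hN : {u₁, u₂, u₃} = G.neighborFinset v₁ := by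
    refine Finset.eq_of_subset_of_card_le ?_ ?_
    · intro w hw
      simp only [Finset.mem_insert, Finset.mem_singleton] at hw
      rw [mem_neighborFinset]
      rcases hw with rfl | rfl | rfl
      exacts [h₁.adj_mid_left.symm, h₂.adj_mid_left.symm, h₃.adj_mid_left.symm]
    · rw [Finset.card_eq_three.2 ⟨_, _, _, hu h₁ h₂ h12, hu h₁ h₃ h13, hu h₂ h₃ h23, rfl⟩]
      exact hd
  refine nonempty_iso_spider222 hG.connected (fun w => ?_) h₁ h₂ h₃ ?_
  · rw [← mem_neighborFinset, ← hN]
    simp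
  · have := hu h₁ h₂ h12
    have := hu h₁ h₃ h13
    have := hu h₂ h₃ h23
    have := hux h₁ l₁
    have := hux h₁ l₂
    have := hux h₁ l₃
    have := hux h₂ l₁
    have := hux h₂ l₂
    have := hux h₂ l₃
    have := hux h₃ l₁
    have := hux h₃ l₂
    have := hux h₃ l₃
    have := hvx h₁ l₁
    have := hvx h₁ l₂
    have := hvx h₁ l₃
    have := h₁.adj_mid_left.ne
    have := h₂.adj_mid_left.ne
    have := h₃.adj_mid_left.ne
    rw [← List.nodup_ofFn]
    simp
    grind

theorem limbNumber_natCast [Fintype V] (k : ℕ) :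
    limbNumber G k = {p : V × Set V | G.IsLimb p.1 p.2 ∧ p.2.ncard = k}.ncard := by
  simp [limbNumber, IsLimb]

theorem ncard_leaves_le_limbNumber_one [Fintype V] : {x | G.IsLeaf x}.ncard ≤ limbNumber G 1 := by
  rw [← Nat.cast_one, limbNumber_natCast]
  choose! f hf using fun x (hx : x ∈ {x | G.IsLeaf x}) => hx
  refine Set.ncard_le_ncard_of_injOn (fun x => (f x, {x})) ?_ ?_
  · exact fun x hx => ⟨isLimb_singleton (hf x hx), Set.ncard_singleton x⟩
  · intro x _ y _ hxy
    simpa using congrArg Prod.snd hxy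

end SimpleGraph

open SimpleGraph in
theorem stmt_5 {V : Type*} [Fintype V] (G : SimpleGraph V) (hG : G.IsTree)
    (h1 : limbNumber G 1 = 3) (h2 : limbNumber G 2 = 3) (h3 : limbNumber G 3 = 0) :
    Nonempty (G ≃g spider222) := by
  have hleaves := h1 ▸ ncard_leaves_le_limbNumber_one (G := G)
  replace h2 : {p : V × Set V | G.IsLimb p.1 p.2 ∧ p.2.ncard = 2}.ncard = 3 :=
    (limbNumber_natCast 2).symm.trans h2
  replace h3 : {p : V × Set V | G.IsLimb p.1 p.2 ∧ p.2.ncard = 3}.ncard = 0 :=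
    (limbNumber_natCast 3).symm.trans h3
  rw [Set.ncard_eq_zero] at h3
  obtain ⟨p₁, p₂, p₃, h12, h13, h23, hp⟩ := Set.ncard_eq_three.1 h2
  have htail : ∀ p ∈ ({p₁, p₂, p₃} : Set (V × Set V)),
      ∃ u x, p.2 = {u, x} ∧ G.IsTail p.1 u x := by
    rw [← hp]
    exact fun p hp => hp.1.exists_isTail hG hp.2
  obtain ⟨u₁, x₁, e₁, t₁⟩ := htail p₁ (by simp)
  obtain ⟨u₂, x₂, e₂, t₂⟩ := htail p₂ (by simp)
  obtain ⟨u₃, x₃, e₃, t₃⟩ := htail p₃ (by simp)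
  have hinj : ∀ {p q : V × Set V} {u x u' x'}, p.2 = {u, x} → q.2 = {u', x'} →
      G.IsTail p.1 u x → G.IsTail q.1 u' x' → p ≠ q → x ≠ x' := by
    rintro p q u x u' x' e e' t t' hpq rfl
    obtain rfl := (t.adj_leaf u').1 t'.adj_mid_right.symm
    exact hpq (Prod.ext (((t'.adj_mid p.1).1 t.adj_mid_left).resolve_right t.ne) (e.trans e'.symm))
  have g12 := hinj e₁ e₂ t₁ t₂ h12
  have g13 := hinj e₁ e₃ t₁ t₃ h13
  have g23 := hinj e₂ e₃ t₂ t₃ h23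
  have hL : {x₁, x₂, x₃} = {x | G.IsLeaf x} := by
    refine Set.eq_of_subset_of_ncard_le ?_ ?_
    · rintro w (rfl | rfl | rfl)
      exacts [⟨_, t₁.adj_leaf⟩, ⟨_, t₂.adj_leaf⟩, ⟨_, t₃.adj_leaf⟩]
    · rwa [Set.ncard_eq_three.2 ⟨_, _, _, g12, g13, g23, rfl⟩]
  refine nonempty_iso_spider222_of_isTail hG t₁ t₂ t₃ g12 g13 g23 (fun w hw => ?_) fun y S hS h => ?_
  · have : w ∈ ({x₁, x₂, x₃} : Set V) := hL ▸ hw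
    exact this
  · exact (Set.eq_empty_iff_forall_notMem.1 h3 (y, S)) ⟨hS, h⟩
end

section
/- Let G be a finite tree with vertex set V, where |V| = n ≥ 1. Suppose P assigns a real number to every nonempty subset S ⊆ V whose induced subgraph is connected (hence a subtree of G), and that P satisfies for every such S the recursion P(S) = max over v ∈ S of [1 − (1/|S|)·Σ_C |C|·P(C)], where C ranges over the vertex sets of the connected components of the subgraph of G induced on S ∖ {v}. Then P(V) = 1/2 + 1/(2n) if n is odd, and P(V) = 1/2 if n is even. (Here P(S) is the probability that the first player wins the tree search game on the subtree induced by S when both players play optimally.) -/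
namespace SimpleGraph

variable {V : Type*}

/-- A connected component of an induced subgraph induces a connected subgraph of the ambient
graph. -/
theorem connected_induce_image_supp (G : SimpleGraph V) (T : Set V)
    (c : (G.induce T).ConnectedComponent) :
    (G.induce (Subtype.val '' c.supp)).Connected := by
  let f : c.toSimpleGraph →g G.induce (Subtype.val '' c.supp) :=
    { toFun := fun x => ⟨x.1.1, x.1, x.2, rfl⟩
      map_rel' := fun h => h }
  refine c.connected_toSimpleGraph.map f ?_
  rintro ⟨_, x, hx, rfl⟩
  exact ⟨⟨x, hx⟩, rfl⟩

theorem sum_ncard_image_supp [Finite V] (G : SimpleGraph V) (T : Set V)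
    [Fintype (G.induce T).ConnectedComponent] :
    ∑ c : (G.induce T).ConnectedComponent, (Subtype.val '' c.supp).ncard = T.ncard := by
  have h := Nat.card_congr (Equiv.sigmaFiberEquiv (G.induce T).connectedComponentMk)
  rw [Nat.card_sigma] at h
  rw [← Nat.card_coe_set_eq T, ← h]
  refine Finset.sum_congr rfl fun c _ => ?_
  rw [Set.ncard_image_of_injective _ Subtype.val_injective]
  rfl

/-- A finite connected graph has a vertex whose removal leaves at most one component. -/
theorem Connected.exists_preconnected_induce_sdiff_singleton [Finite V] {G : SimpleGraph V}
    {S : Set V} (hS : (G.induce S).Connected) :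
    ∃ v : S, (G.induce (S \ {(v : V)})).Preconnected := by
  obtain ⟨v, hv⟩ := hS.exists_preconnected_induce_compl_singleton_of_finite
  let f : (G.induce S).induce {v}ᶜ →g G.induce (S \ {(v : V)}) :=
    { toFun := fun x => ⟨x.1.1, x.1.2, fun h => x.2 (Subtype.ext h)⟩
      map_rel' := fun h => h }
  refine ⟨v, hv.map f ?_⟩
  rintro ⟨x, hx, hxv⟩
  exact ⟨⟨⟨x, hx⟩, fun h => hxv (congrArg Subtype.val h)⟩, rfl⟩

/-- The value of the tree search game on a connected set, scaled by the size of the set. -/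
theorem ncard_mul_treeSearch_value [Finite V] (G : SimpleGraph V) (P : Set V → ℝ)
    (hP : ∀ S : Set V, S.Nonempty → (G.induce S).Connected →
      P S = ⨆ v : S, (1 - (1 / (S.ncard : ℝ)) *
        ∑ᶠ c : (G.induce (S \ {(v : V)})).ConnectedComponent,
          ((Subtype.val '' c.supp).ncard : ℝ) * P (Subtype.val '' c.supp)))
    (S : Set V) (hne : S.Nonempty) (hS : (G.induce S).Connected) :
    (S.ncard : ℝ) * P S = ((S.ncard + 1) / 2 : ℕ) := by
  classical
  induction hm : S.ncard using Nat.strong_induction_on generalizing S with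
  | _ m ih =>
  have hpos : 0 < m := hm ▸ (Set.ncard_pos).2 hne
  have hcard (v : S) : (S \ {(v : V)}).ncard + 1 = m :=
    hm ▸ Set.ncard_sdiff_singleton_add_one v.2
  have hsum (v : S) [Fintype (G.induce (S \ {(v : V)})).ConnectedComponent] :
      ∑ᶠ c : (G.induce (S \ {(v : V)})).ConnectedComponent,
        ((Subtype.val '' c.supp).ncard : ℝ) * P (Subtype.val '' c.supp) =
      (∑ c : (G.induce (S \ {(v : V)})).ConnectedComponent,
        ((Subtype.val '' c.supp).ncard + 1) / 2 : ℕ) := by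
    rw [finsum_eq_sum_of_fintype, Nat.cast_sum]
    refine Finset.sum_congr rfl fun c _ => ?_
    refine ih _ ?_ _ (c.nonempty_supp.image _) (connected_induce_image_supp G _ c) rfl
    have : (Subtype.val '' c.supp).ncard ≤ (S \ {(v : V)}).ncard :=
      Set.ncard_le_ncard (by rintro _ ⟨x, -, rfl⟩; exact x.2)
    have := hcard v
    omega
  have hm0 : (m : ℝ) ≠ 0 := by positivity
  have hhalf : (((m + 1) / 2 : ℕ) : ℝ) = m - (m / 2 : ℕ) := by
    rw [eq_sub_iff_add_eq]
    exact_mod_cast (by omega : (m + 1) / 2 + m / 2 = m)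
  have hmax : IsGreatest (Set.range fun v : S => 1 - (1 / (m : ℝ)) *
      ∑ᶠ c : (G.induce (S \ {(v : V)})).ConnectedComponent,
        ((Subtype.val '' c.supp).ncard : ℝ) * P (Subtype.val '' c.supp))
      (1 - (1 / (m : ℝ)) * (m / 2 : ℕ)) := by
    constructor
    · obtain ⟨v, hv⟩ := hS.exists_preconnected_induce_sdiff_singleton
      refine ⟨v, ?_⟩
      have := Fintype.ofFinite (G.induce (S \ {(v : V)})).ConnectedComponent
      have hsub := hv.subsingleton_connectedComponent
      have htot := sum_ncard_image_supp G (S \ {(v : V)})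
      have hv' := hcard v
      beta_reduce
      rw [hsum v]
      congr 3
      rcases isEmpty_or_nonempty (G.induce (S \ {(v : V)})).ConnectedComponent with h | ⟨⟨c⟩⟩
      · simp only [Finset.univ_eq_empty, Finset.sum_empty] at htot ⊢
        omega
      · rw [Fintype.sum_subsingleton _ c] at htot ⊢
        omega
    · rintro _ ⟨v, rfl⟩
      have := Fintype.ofFinite (G.induce (S \ {(v : V)})).ConnectedComponent
      have htot := sum_ncard_image_supp G (S \ {(v : V)})
      have hv' := hcard v
      have hle : ∑ c : (G.induce (S \ {(v : V)})).ConnectedComponent,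
          (Subtype.val '' c.supp).ncard ≤
          2 * ∑ c : (G.induce (S \ {(v : V)})).ConnectedComponent,
            ((Subtype.val '' c.supp).ncard + 1) / 2 := by
        rw [Finset.mul_sum]
        exact Finset.sum_le_sum fun c _ => by omega
      beta_reduce
      rw [hsum v]
      gcongr
      omega
  rw [hP S hne hS, hm, ← sSup_range, hmax.csSup_eq, hhalf]
  field_simp

end SimpleGraph

theorem stmt_6 {V : Type*} [Fintype V] (G : SimpleGraph V) (hG : G.IsTree)
    (hn : 1 ≤ Fintype.card V)
    (P : Set V → ℝ)
    (hP : ∀ S : Set V, S.Nonempty → (G.induce S).Connected →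
      P S = ⨆ v : S, (1 - (1 / (S.ncard : ℝ)) *
        ∑ᶠ c : (G.induce (S \ {(v : V)})).ConnectedComponent,
          ((Subtype.val '' c.supp).ncard : ℝ) * P (Subtype.val '' c.supp))) :
    P Set.univ =
      if Odd (Fintype.card V) then 1 / 2 + 1 / (2 * (Fintype.card V : ℝ)) else 1 / 2 := by
  have hne : Nonempty V := hG.1.nonempty
  have hconn : (G.induce Set.univ).Connected := (SimpleGraph.induceUnivIso G).connected_iff.2 hG.1
  have h := G.ncard_mul_treeSearch_value P hP Set.univ Set.univ_nonempty hconn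
  rw [Set.ncard_univ, Nat.card_eq_fintype_card] at h
  have h0 : (Fintype.card V : ℝ) ≠ 0 := by positivity
  rw [← mul_right_inj' h0, h]
  split_ifs with hodd
  · obtain ⟨k, hk⟩ := hodd
    rw [hk, show (2 * k + 1 + 1) / 2 = k + 1 by omega]
    push_cast
    have : (2 * (k : ℝ) + 1) ≠ 0 := by positivity
    field_simp
    ring
  · obtain ⟨k, hk⟩ := Nat.not_odd_iff_even.1 hodd
    rw [hk, show (k + k + 1) / 2 = k by omega]
    push_cast
    ring
end

section
/- Let a, b : ℕ → ℝ satisfy a_1 = 1, b_1 = 0, and for every integer n ≥ 2, a_n = 1/n + ((n−1)/n)·b_{n−1} and b_n = (n−1)/n² + ((n−1)/n)²·a_{n−1}. Then for every positive integer n: a_n = 2/3 − 1/(3n) + (2/(3n))·(binom(n−1, (n−1)/2)/2^{n−1}) if n is odd and a_n = 2/3 − 1/(3n) if n is even; and b_n = 2/3 − 2/(3n) + (2/(3n))·(binom(n, n/2)/2^n) if n is even and b_n = 2/3 − 2/(3n) if n is odd. -/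
/-- Closed-form win probability for an optimally playing **first** player against a uniformly
random opponent in the tree search game on the star with `n` vertices. -/
noncomputable def starP (n : ℕ) : ℝ :=
  2 / 3 - 1 / (3 * (n : ℝ)) +
    if Odd n then (2 / (3 * (n : ℝ))) * (((n - 1).choose ((n - 1) / 2) : ℝ) / 2 ^ (n - 1))
    else 0

/-- Closed-form win probability for an optimally playing **second** player against a uniformly
random opponent in the tree search game on the star with `n` vertices. -/
noncomputable def starQ (n : ℕ) : ℝ :=
  2 / 3 - 2 / (3 * (n : ℝ)) +
    if Even n then (2 / (3 * (n : ℝ))) * ((n.choose (n / 2) : ℝ) / 2 ^ n)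
    else 0

theorem starP_odd (m : ℕ) :
    starP (2 * m + 1) = 2 / 3 - 1 / (3 * (2 * m + 1 : ℝ)) +
      2 / (3 * (2 * m + 1 : ℝ)) * ((m.centralBinom : ℝ) / 4 ^ m) := by
  have h : Odd (2 * m + 1) := odd_two_mul_add_one m
  have h4 : (2 : ℝ) ^ (2 * m) = 4 ^ m := by rw [pow_mul]; norm_num
  simp [starP, h, h4, Nat.centralBinom]

theorem starP_even (m : ℕ) :
    starP (2 * m) = 2 / 3 - 1 / (3 * (2 * m : ℝ)) := by
  simp [starP]

theorem starQ_odd (m : ℕ) :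
    starQ (2 * m + 1) = 2 / 3 - 2 / (3 * (2 * m + 1 : ℝ)) := by
  simp [starQ]

theorem starQ_even (m : ℕ) :
    starQ (2 * m) = 2 / 3 - 2 / (3 * (2 * m : ℝ)) +
      2 / (3 * (2 * m : ℝ)) * ((m.centralBinom : ℝ) / 4 ^ m) := by
  have h4 : (2 : ℝ) ^ (2 * m) = 4 ^ m := by rw [pow_mul]; norm_num
  simp [starQ, h4, Nat.centralBinom]

theorem centralBinom_succ_div_four_pow (m : ℕ) :
    ((m + 1).centralBinom : ℝ) / 4 ^ (m + 1) =
      (2 * m + 1) / (2 * m + 2) * ((m.centralBinom : ℝ) / 4 ^ m) := by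
  have h : ((m : ℝ) + 1) * (m + 1).centralBinom = 2 * (2 * m + 1) * m.centralBinom := by
    exact_mod_cast Nat.succ_mul_centralBinom_succ m
  rw [pow_succ]
  field_simp
  linear_combination 2 * h

theorem starP_succ (n : ℕ) (hn : 1 ≤ n) :
    starP (n + 1) = 1 / (n + 1 : ℝ) + n / (n + 1 : ℝ) * starQ n := by
  obtain ⟨m, rfl | rfl⟩ := n.even_or_odd'
  · have hm : (m : ℝ) ≠ 0 := by
      norm_cast
      omega
    rw [starP_odd, starQ_even]
    push_cast
    field_simp
    ring
  · have h : starP (2 * m + 1 + 1) = _ := starP_even (m + 1)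
    rw [h, starQ_odd]
    push_cast
    field_simp
    ring

theorem starQ_succ (n : ℕ) (hn : 1 ≤ n) :
    starQ (n + 1) = n / (n + 1 : ℝ) ^ 2 + (n / (n + 1 : ℝ)) ^ 2 * starP n := by
  obtain ⟨m, rfl | rfl⟩ := n.even_or_odd'
  · have hm : (m : ℝ) ≠ 0 := by
      norm_cast
      omega
    rw [starQ_odd, starP_even]
    push_cast
    field_simp
    ring
  · have h : starQ (2 * m + 1 + 1) = _ := starQ_even (m + 1)
    rw [h, starP_odd, centralBinom_succ_div_four_pow]
    generalize (m.centralBinom : ℝ) / 4 ^ m = c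
    push_cast
    field_simp
    ring

theorem stmt_7 (a b : ℕ → ℝ) (ha1 : a 1 = 1) (hb1 : b 1 = 0)
    (ha : ∀ n : ℕ, 2 ≤ n →
      a n = 1 / (n : ℝ) + (((n : ℝ) - 1) / (n : ℝ)) * b (n - 1))
    (hb : ∀ n : ℕ, 2 ≤ n →
      b n = ((n : ℝ) - 1) / (n : ℝ) ^ 2 + (((n : ℝ) - 1) / (n : ℝ)) ^ 2 * a (n - 1)) :
    ∀ n : ℕ, 1 ≤ n → a n = starP n ∧ b n = starQ n := by
  intro n hn
  induction n, hn using Nat.le_induction with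
  | base =>
    rw [ha1, hb1]
    norm_num [starP, starQ]
  | succ n hn ih =>
    rw [ha (n + 1) (by omega), hb (n + 1) (by omega), starP_succ n hn, starQ_succ n hn]
    simp [ih.1, ih.2]
end

section
/- For every positive integer n, p_n = 1/n + ((n−1)/n)·q_{n−1}. -/
/-- `pathP n` is the win probability for an optimally playing **first** player against a
uniformly random opponent in the tree search game on the path with `n` vertices
(with the convention `pathP 0 = 1/2`). -/
noncomputable def pathP (n : ℕ) : ℝ :=
  if n = 0 then 1 / 2 else
    1 / 2 - (1 / (n : ℝ)) * ((-2 : ℝ) ^ n / (n.factorial : ℝ))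
      + (((n : ℝ) + 2) / (2 * (n : ℝ))) *
          ∑ j ∈ Finset.range (n + 1), (-2 : ℝ) ^ j / (j.factorial : ℝ)

/-- `pathQ n` is the win probability for an optimally playing **second** player against a
uniformly random opponent in the tree search game on the path with `n` vertices
(with the convention `pathQ 0 = 1/2`). -/
noncomputable def pathQ (n : ℕ) : ℝ :=
  if n = 0 then 1 / 2 else
    ((n : ℝ) - 1) / (2 * (n : ℝ)) - (1 / (n : ℝ)) * ((-2 : ℝ) ^ n / (n.factorial : ℝ))
      + (((n : ℝ) + 3) / (2 * (n : ℝ))) *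
          ∑ j ∈ Finset.range (n + 1), (-2 : ℝ) ^ j / (j.factorial : ℝ)

theorem stmt_9 (n : ℕ) (hn : 1 ≤ n) :
    pathP n = 1 / (n : ℝ) + (((n : ℝ) - 1) / (n : ℝ)) * pathQ (n - 1) := by
  obtain _ | _ | m := n
  · omega
  · norm_num [pathP, Finset.sum_range_succ]
  · have hm : (m : ℝ) + 1 ≠ 0 := by positivity
    have hm' : (m : ℝ) + 1 + 1 ≠ 0 := by positivity
    have hf : ((m + 1).factorial : ℝ) ≠ 0 := by positivity
    simp only [pathP, pathQ, Nat.add_sub_cancel, Nat.add_eq_zero_iff, one_ne_zero, and_false,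
      if_false]
    rw [Finset.sum_range_succ _ (m + 1 + 1), Nat.factorial_succ (m + 1), pow_succ _ (m + 1)]
    generalize ∑ j ∈ Finset.range (m + 1 + 1), (-2 : ℝ) ^ j / (j.factorial : ℝ) = S
    push_cast
    field_simp
    ring
end

section
/- For every positive integer n, q_n = (1/n)·Σ_{k=1}^{n} [((k−1)/n)·p_{k−1} + ((n−k)/n)·p_{n−k}]. -/
/-- Clearing denominators in `pathP`; the identity also holds for `n = 0`. -/
lemma natCast_mul_pathP (n : ℕ) :
    (n : ℝ) * pathP n = n / 2 - (-2 : ℝ) ^ n / n.factorial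
      + (n + 2) / 2 * ∑ j ∈ Finset.range (n + 1), (-2 : ℝ) ^ j / j.factorial := by
  rcases eq_or_ne n 0 with rfl | hn
  · simp
  · have hn' : (n : ℝ) ≠ 0 := Nat.cast_ne_zero.mpr hn
    rw [pathP, if_neg hn]
    generalize (-2 : ℝ) ^ n / n.factorial = t
    field_simp

/-- Clearing denominators in `pathQ`; the identity also holds for `n = 0`. -/
lemma natCast_sq_mul_pathQ (n : ℕ) :
    (n : ℝ) ^ 2 * pathQ n = n * (n - 1) / 2 - n * ((-2 : ℝ) ^ n / n.factorial)
      + n * (n + 3) / 2 * ∑ j ∈ Finset.range (n + 1), (-2 : ℝ) ^ j / j.factorial := by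
  rcases eq_or_ne n 0 with rfl | hn
  · simp
  · have hn' : (n : ℝ) ≠ 0 := Nat.cast_ne_zero.mpr hn
    rw [pathQ, if_neg hn]
    generalize (-2 : ℝ) ^ n / n.factorial = t
    field_simp

lemma two_mul_sum_natCast_mul_pathP (n : ℕ) :
    2 * ∑ m ∈ Finset.range n, (m : ℝ) * pathP m = (n : ℝ) ^ 2 * pathQ n := by
  induction n with
  | zero => simp
  | succ n ih =>
    have ht : ((n : ℝ) + 1) * ((-2 : ℝ) ^ (n + 1) / (n + 1).factorial)
        = -2 * ((-2 : ℝ) ^ n / n.factorial) := by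
      have := n.factorial_ne_zero
      rw [Nat.factorial_succ]
      push_cast
      field_simp
      ring
    rw [Finset.sum_range_succ, mul_add, ih, natCast_sq_mul_pathQ, natCast_sq_mul_pathQ,
      natCast_mul_pathP, Finset.sum_range_succ _ (n + 1)]
    push_cast
    linear_combination (-((n : ℝ) + 2) / 2) * ht

theorem stmt_10 (n : ℕ) (hn : 1 ≤ n) :
    pathQ n = (1 / (n : ℝ)) * ∑ k ∈ Finset.Icc 1 n,
      ((((k : ℝ) - 1) / (n : ℝ)) * pathP (k - 1) +
        (((n : ℝ) - (k : ℝ)) / (n : ℝ)) * pathP (n - k)) := by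
  have hn' : (n : ℝ) ≠ 0 := Nat.cast_ne_zero.mpr (by omega)
  have hleft : ∑ k ∈ Finset.Icc 1 n, ((k : ℝ) - 1) / n * pathP (k - 1)
      = (∑ m ∈ Finset.range n, (m : ℝ) * pathP m) / n := by
    rw [Finset.sum_div]
    refine Finset.sum_nbij' (fun k => k - 1) (fun m => m + 1) ?_ ?_ ?_ ?_ ?_ <;>
      simp only [Finset.mem_Icc, Finset.mem_range]
    · omega
    · omega
    · omega
    · omega
    · intro k hk
      rw [Nat.cast_pred (by omega)]
      ring
  have hright : ∑ k ∈ Finset.Icc 1 n, ((n : ℝ) - k) / n * pathP (n - k)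
      = (∑ m ∈ Finset.range n, (m : ℝ) * pathP m) / n := by
    rw [Finset.sum_div]
    refine Finset.sum_nbij' (fun k => n - k) (fun m => n - m) ?_ ?_ ?_ ?_ ?_ <;>
      simp only [Finset.mem_Icc, Finset.mem_range]
    · omega
    · omega
    · omega
    · omega
    · intro k hk
      rw [Nat.cast_sub hk.2]
      ring
  rw [Finset.sum_add_distrib, hleft, hright]
  field_simp
  linear_combination -two_mul_sum_natCast_mul_pathP n
end

section
/- For every positive integer n, n·q_n ≤ ((1 + e^{−2})/2)·n − 1/8. Furthermore, for every integer n ≥ 3, ((1 + e^{−2})/2)·n − 3/8 ≤ n·q_n ≤ ((1 + e^{−2})/2)·n − 1/4. -/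
theorem abs_exp_neg_two_sub_sum_le (n : ℕ) (hn : 2 ≤ n) :
    |Real.exp (-2) - ∑ j ∈ Finset.range (n + 1), (-2 : ℝ) ^ j / (j.factorial : ℝ)| ≤
      2 ^ (n + 1) / ((n + 1).factorial : ℝ) * 2 := by
  have hn' : (2 : ℝ) ≤ n := by exact_mod_cast hn
  have h := Complex.exp_bound' (x := ((-2 : ℝ) : ℂ)) (n := n + 1) (by
    rw [Complex.norm_real, Real.norm_eq_abs, abs_neg, abs_two, div_le_div_iff₀ (by positivity)
      (by norm_num)]
    push_cast
    linarith)
  have hcast : Complex.exp ((-2 : ℝ) : ℂ) -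
      ∑ j ∈ Finset.range (n + 1), ((-2 : ℝ) : ℂ) ^ j / (j.factorial : ℂ) =
      ((Real.exp (-2) - ∑ j ∈ Finset.range (n + 1), (-2 : ℝ) ^ j / (j.factorial : ℝ) : ℝ) : ℂ) := by
    push_cast
    rfl
  rw [hcast] at h
  simpa only [Complex.norm_real, Real.norm_eq_abs, abs_neg, abs_two] using h

theorem two_pow_div_factorial_le (n : ℕ) (hn : 8 ≤ n) :
    (2 : ℝ) ^ n / (n.factorial : ℝ) ≤ 2 / 315 := by
  induction n, hn using Nat.le_induction with
  | base => norm_num [Nat.factorial]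
  | succ m hm ih =>
    have hm' : (8 : ℝ) ≤ m := by exact_mod_cast hm
    have hstep : (2 : ℝ) ^ (m + 1) / ((m + 1).factorial : ℝ) =
        2 / ((m : ℝ) + 1) * (2 ^ m / (m.factorial : ℝ)) := by
      rw [Nat.factorial_succ, pow_succ]
      push_cast
      field_simp
    have hfac : 2 / ((m : ℝ) + 1) ≤ 1 := by
      rw [div_le_one (by positivity)]
      linarith
    rw [hstep]
    exact (mul_le_of_le_one_left (by positivity) hfac).trans ih

theorem natCast_mul_pathQ (n : ℕ) (hn : 1 ≤ n) :
    (n : ℝ) * pathQ n = (n - 1) / 2 - (-2 : ℝ) ^ n / (n.factorial : ℝ) +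
      (n + 3) / 2 * ∑ j ∈ Finset.range (n + 1), (-2 : ℝ) ^ j / (j.factorial : ℝ) := by
  have hn' : (n : ℝ) ≠ 0 := by positivity
  rw [pathQ, if_neg (by lia)]
  field_simp

theorem exp_neg_two_bounds : 0.1353 < Real.exp (-2) ∧ Real.exp (-2) < 0.1354 := by
  have hmul : Real.exp (-2) * (Real.exp 1 * Real.exp 1) = 1 := by
    rw [← Real.exp_add, ← Real.exp_add]
    norm_num
  have hlo := Real.exp_one_gt_d9
  have hhi := Real.exp_one_lt_d9
  have hpos := Real.exp_pos (-2)
  have hsqlo : 7.388 < Real.exp 1 * Real.exp 1 := by nlinarith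
  have hsqhi : Real.exp 1 * Real.exp 1 < 7.39 := by nlinarith
  constructor <;> nlinarith

/-- The tail case: the error terms around `3 / 2 * exp (-2) - 1 / 2` are below `0.022`. -/
theorem abs_natCast_mul_pathQ_sub_le (n : ℕ) (hn : 8 ≤ n) :
    |(n : ℝ) * pathQ n - ((1 + Real.exp (-2)) / 2 * n + (3 / 2 * Real.exp (-2) - 1 / 2))| ≤
      0.022 := by
  have hn' : (8 : ℝ) ≤ n := by exact_mod_cast hn
  have htail := abs_exp_neg_two_sub_sum_le n (by lia)
  have hterm := two_pow_div_factorial_le n hn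
  have habs : |(-2 : ℝ) ^ n / (n.factorial : ℝ)| = 2 ^ n / (n.factorial : ℝ) := by
    rw [abs_div, abs_pow, abs_neg, abs_two, Nat.abs_cast]
  rw [natCast_mul_pathQ n (by lia)]
  set S := ∑ j ∈ Finset.range (n + 1), (-2 : ℝ) ^ j / (j.factorial : ℝ)
  have hscaled : |(n + 3) / 2 * (Real.exp (-2) - S)| ≤ 22 / 9 * (2 ^ n / (n.factorial : ℝ)) := by
    rw [abs_mul, abs_of_pos (by positivity)]
    calc ((n : ℝ) + 3) / 2 * |Real.exp (-2) - S|
        ≤ (n + 3) / 2 * (2 ^ (n + 1) / ((n + 1).factorial : ℝ) * 2) := by gcongr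
      _ = 2 * ((n + 3) / (n + 1)) * (2 ^ n / (n.factorial : ℝ)) := by
          rw [Nat.factorial_succ, pow_succ]
          push_cast
          field_simp
      _ ≤ 22 / 9 * (2 ^ n / (n.factorial : ℝ)) := by
          gcongr
          rw [mul_div_assoc', div_le_div_iff₀ (by positivity) (by norm_num)]
          linarith
  have h₁ := abs_le.mp hscaled
  have h₂ := abs_le.mp habs.le
  rw [abs_le]
  constructor <;> nlinarith

theorem natCast_mul_pathQ_bounds (n : ℕ) (hn : 3 ≤ n) :
    ((1 + Real.exp (-2)) / 2) * n - 3 / 8 ≤ (n : ℝ) * pathQ n ∧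
      (n : ℝ) * pathQ n ≤ ((1 + Real.exp (-2)) / 2) * n - 1 / 4 := by
  obtain ⟨hlo, hhi⟩ := exp_neg_two_bounds
  rcases lt_or_ge n 8 with h | h
  · rw [natCast_mul_pathQ n (by lia)]
    interval_cases n <;> norm_num [Finset.sum_range_succ, Nat.factorial] <;>
      constructor <;> linarith
  · have := abs_le.mp (abs_natCast_mul_pathQ_sub_le n h)
    constructor <;> linarith

theorem stmt_11 :
    (∀ n : ℕ, 1 ≤ n →
      (n : ℝ) * pathQ n ≤ ((1 + Real.exp (-2)) / 2) * n - 1 / 8) ∧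
    (∀ n : ℕ, 3 ≤ n →
      ((1 + Real.exp (-2)) / 2) * n - 3 / 8 ≤ (n : ℝ) * pathQ n ∧
        (n : ℝ) * pathQ n ≤ ((1 + Real.exp (-2)) / 2) * n - 1 / 4) := by
  refine ⟨fun n hn => ?_, natCast_mul_pathQ_bounds⟩
  rcases lt_or_ge n 3 with h | h
  · obtain ⟨hlo, hhi⟩ := exp_neg_two_bounds
    rw [natCast_mul_pathQ n hn]
    interval_cases n <;> norm_num [Finset.sum_range_succ, Nat.factorial] <;> linarith
  · linarith [(natCast_mul_pathQ_bounds n h).2]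
end

section
/- For all nonnegative integers m and n, m·q_m + n·q_n ≤ (m+n)·q_{m+n}; that is, the sequence (n·q_n) is superadditive. -/
/-- A sequence whose even-indexed subsequence is monotone, and in which every even-indexed term is
at most its successor, has each even-indexed term below all later terms. -/
lemma le_of_even_index_le {v : ℕ → ℝ} (h₁ : ∀ k, v (2 * k) ≤ v (2 * k + 1))
    (h₂ : ∀ k, v (2 * k) ≤ v (2 * k + 2)) (k m : ℕ) : v (2 * k) ≤ v (m + 2 * k) := by
  have hmono : Monotone fun i => v (2 * i) := monotone_nat_of_le_succ h₂
  obtain ⟨i, rfl | rfl⟩ := Nat.even_or_odd' m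
  · rw [← mul_add]
    exact hmono (Nat.le_add_left k i)
  · rw [show 2 * i + 1 + 2 * k = 2 * (i + k) + 1 by ring]
    exact (hmono (Nat.le_add_left k i)).trans (h₁ _)

/-- A sequence starting at zero is superadditive if its one-step and two-step increments at an even
index are at most the corresponding increments at every later index. -/
lemma superadditive_of_increments {a : ℕ → ℝ} (h0 : a 0 = 0)
    (h₁ : ∀ k m, a (2 * k + 1) - a (2 * k) ≤ a (m + 2 * k + 1) - a (m + 2 * k))
    (h₂ : ∀ k m, a (2 * k + 2) - a (2 * k) ≤ a (m + 2 * k + 2) - a (m + 2 * k)) (m n : ℕ) :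
    a m + a n ≤ a (m + n) := by
  have heven : ∀ k, a m + a (2 * k) ≤ a (m + 2 * k) := by
    intro k
    induction k with
    | zero => simp [h0]
    | succ k ih =>
      have := h₂ k m
      rw [show 2 * (k + 1) = 2 * k + 2 by ring, ← add_assoc]
      linarith
  obtain ⟨k, rfl | rfl⟩ := Nat.even_or_odd' n
  · exact heven k
  · have := h₁ k m
    have := heven k
    rw [← add_assoc]
    linarith

/-- The `n`-th term of the power series of `exp (-2)`. -/
noncomputable def expNegTwoTerm (n : ℕ) : ℝ := (-2 : ℝ) ^ n / (n.factorial : ℝ)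

/-- The partial sum, up to and including the `n`-th term, of the power series of `exp (-2)`. -/
noncomputable def expNegTwoSum (n : ℕ) : ℝ := ∑ j ∈ Finset.range (n + 1), expNegTwoTerm j

lemma expNegTwoTerm_succ (n : ℕ) :
    expNegTwoTerm (n + 1) = -2 / ((n : ℝ) + 1) * expNegTwoTerm n := by
  have : (n.factorial : ℝ) ≠ 0 := by positivity
  simp only [expNegTwoTerm, Nat.factorial_succ, pow_succ]
  push_cast
  field_simp

lemma expNegTwoTerm_even_nonneg (k : ℕ) : 0 ≤ expNegTwoTerm (2 * k) := by
  rw [expNegTwoTerm, pow_mul]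
  positivity

lemma expNegTwoSum_succ (n : ℕ) :
    expNegTwoSum (n + 1) = expNegTwoSum n + expNegTwoTerm (n + 1) :=
  Finset.sum_range_succ _ _

lemma mul_pathQ (n : ℕ) :
    (n : ℝ) * pathQ n =
      ((n : ℝ) - 1) / 2 - expNegTwoTerm n + ((n : ℝ) + 3) / 2 * expNegTwoSum n := by
  rcases eq_or_ne n 0 with rfl | hn
  · norm_num [expNegTwoSum, expNegTwoTerm]
  · have : (n : ℝ) ≠ 0 := by exact_mod_cast hn
    simp only [pathQ, if_neg hn, expNegTwoSum, expNegTwoTerm]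
    field_simp

lemma succ_mul_pathQ_sub (n : ℕ) :
    ((n + 1 : ℕ) : ℝ) * pathQ (n + 1) - (n : ℝ) * pathQ n = (1 + expNegTwoSum (n + 1)) / 2 := by
  rw [mul_pathQ, mul_pathQ, expNegTwoSum_succ, expNegTwoTerm_succ]
  push_cast
  field_simp
  ring

lemma expNegTwoTerm_add_succ_nonneg (k : ℕ) :
    0 ≤ expNegTwoTerm (2 * k + 2) + expNegTwoTerm (2 * k + 3) := by
  have ht : 0 ≤ expNegTwoTerm (2 * k + 2) := expNegTwoTerm_even_nonneg (k + 1)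
  have : expNegTwoTerm (2 * k + 2) + expNegTwoTerm (2 * k + 3) =
      (2 * k + 1) / (2 * k + 3) * expNegTwoTerm (2 * k + 2) := by
    rw [expNegTwoTerm_succ (2 * k + 2)]
    push_cast
    field_simp
    ring
  rw [this]
  positivity

lemma expNegTwoTerm_second_sum_nonneg (k : ℕ) :
    0 ≤ expNegTwoTerm (2 * k + 2) + 2 * expNegTwoTerm (2 * k + 3) + expNegTwoTerm (2 * k + 4) := by
  have ht : 0 ≤ expNegTwoTerm (2 * k + 2) := expNegTwoTerm_even_nonneg (k + 1)
  have : expNegTwoTerm (2 * k + 2) + 2 * expNegTwoTerm (2 * k + 3) + expNegTwoTerm (2 * k + 4) =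
      (2 * k) / (2 * k + 4) * expNegTwoTerm (2 * k + 2) := by
    rw [expNegTwoTerm_succ (2 * k + 3), expNegTwoTerm_succ (2 * k + 2)]
    push_cast
    field_simp
    ring
  rw [this]
  positivity

lemma expNegTwoSum_odd_le (k m : ℕ) :
    expNegTwoSum (2 * k + 1) ≤ expNegTwoSum (m + 2 * k + 1) := by
  refine le_of_even_index_le (v := fun i => expNegTwoSum (i + 1)) (fun k => ?_) (fun k => ?_) k m
  · have : 0 ≤ expNegTwoTerm (2 * k + 2) := expNegTwoTerm_even_nonneg (k + 1)
    linarith [expNegTwoSum_succ (2 * k + 1)]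
  · linarith [expNegTwoSum_succ (2 * k + 1), expNegTwoSum_succ (2 * k + 2),
      expNegTwoTerm_add_succ_nonneg k]

lemma expNegTwoSum_odd_add_succ_le (k m : ℕ) :
    expNegTwoSum (2 * k + 1) + expNegTwoSum (2 * k + 2) ≤
      expNegTwoSum (m + 2 * k + 1) + expNegTwoSum (m + 2 * k + 2) := by
  refine le_of_even_index_le (v := fun i => expNegTwoSum (i + 1) + expNegTwoSum (i + 2))
    (fun k => ?_) (fun k => ?_) k m
  · linarith [expNegTwoSum_succ (2 * k + 1), expNegTwoSum_succ (2 * k + 2),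
      expNegTwoTerm_add_succ_nonneg k]
  · linarith [expNegTwoSum_succ (2 * k + 1), expNegTwoSum_succ (2 * k + 2),
      expNegTwoSum_succ (2 * k + 3), expNegTwoTerm_second_sum_nonneg k]

theorem stmt_12 (m n : ℕ) :
    (m : ℝ) * pathQ m + (n : ℝ) * pathQ n ≤ ((m : ℝ) + (n : ℝ)) * pathQ (m + n) := by
  rw [← Nat.cast_add]
  refine superadditive_of_increments (a := fun i => (i : ℝ) * pathQ i) (by simp)
    (fun k m => ?_) (fun k m => ?_) m n
  · linarith [succ_mul_pathQ_sub (2 * k), succ_mul_pathQ_sub (m + 2 * k), expNegTwoSum_odd_le k m]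
  · linarith [succ_mul_pathQ_sub (2 * k), succ_mul_pathQ_sub (m + 2 * k),
      succ_mul_pathQ_sub (2 * k + 1), succ_mul_pathQ_sub (m + 2 * k + 1),
      expNegTwoSum_odd_add_succ_le k m]
end

section
/- For every positive integer n, p_n = max over integers k with 1 ≤ k ≤ n of [1/n + ((k−1)/n)·q_{k−1} + ((n−k)/n)·q_{n−k}]. -/
/-- The `m`-th term of the exponential series at `-2`. -/
noncomputable def expTerm (m : ℕ) : ℝ := (-2 : ℝ) ^ m / (m.factorial : ℝ)

/-- The sum of the terms of index at most `m` of the exponential series at `-2`. -/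
noncomputable def expSum (m : ℕ) : ℝ := ∑ j ∈ Finset.range (m + 1), expTerm j

/-- The weighted win probability `m * pathQ m`, in closed form. -/
noncomputable def weightedQ (m : ℕ) : ℝ :=
  ((m : ℝ) - 1) / 2 - expTerm m + ((m : ℝ) + 3) / 2 * expSum m

theorem expTerm_zero : expTerm 0 = 1 := by simp [expTerm]

theorem expSum_zero : expSum 0 = 1 := by simp [expSum, expTerm_zero]

theorem expSum_succ (m : ℕ) : expSum (m + 1) = expSum m + expTerm (m + 1) :=
  Finset.sum_range_succ _ _

theorem succ_mul_expTerm_succ (m : ℕ) :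
    ((m : ℝ) + 1) * expTerm (m + 1) = -2 * expTerm m := by
  have h1 : (m.factorial : ℝ) ≠ 0 := by positivity
  have h2 : (m : ℝ) + 1 ≠ 0 := by positivity
  simp only [expTerm, Nat.factorial_succ, Nat.cast_mul, Nat.cast_succ, pow_succ]
  field_simp

theorem abs_expTerm_succ (m : ℕ) :
    ((m : ℝ) + 1) * |expTerm (m + 1)| = 2 * |expTerm m| := by
  have h := congrArg abs (succ_mul_expTerm_succ m)
  have h2 : (0 : ℝ) ≤ (m : ℝ) + 1 := by positivity
  simpa [abs_mul, abs_of_nonneg h2] using h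

theorem expTerm_eq_neg_one_pow_mul_abs (m : ℕ) : expTerm m = (-1) ^ m * |expTerm m| := by
  simp only [expTerm, abs_div, abs_pow, abs_neg, Nat.abs_ofNat, Nat.abs_cast]
  rw [← mul_div_assoc, ← mul_pow]
  norm_num

theorem abs_expTerm_add_two_le (m : ℕ) : |expTerm (m + 2)| ≤ |expTerm (m + 1)| := by
  have h := abs_expTerm_succ (m + 1)
  push_cast at h
  nlinarith [abs_nonneg (expTerm (m + 2)), Nat.cast_nonneg (α := ℝ) m]

theorem abs_expTerm_le_of_le {m n : ℕ} (hm : 1 ≤ m) (h : m ≤ n) :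
    |expTerm n| ≤ |expTerm m| := by
  induction n, h using Nat.le_induction with
  | base => exact le_rfl
  | succ n hmn ih =>
    obtain ⟨k, rfl⟩ := Nat.exists_eq_add_of_le' (hm.trans hmn)
    exact (abs_expTerm_add_two_le k).trans ih

/-- The alternating series estimate. -/
theorem expSum_sub_mem_Icc (m k : ℕ) :
    (-1 : ℝ) ^ (m + 1) * (expSum (m + k) - expSum m) ∈ Set.Icc 0 |expTerm (m + 1)| := by
  induction k generalizing m with
  | zero => simp
  | succ k ih =>
    obtain ⟨h0, h1⟩ := ih (m + 1)
    have hle := abs_expTerm_add_two_le m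
    have hs : (-1 : ℝ) ^ (m + 1) * expTerm (m + 1) = |expTerm (m + 1)| := by
      conv_lhs => rw [expTerm_eq_neg_one_pow_mul_abs]
      rw [← mul_assoc, ← mul_pow]
      norm_num
    have key : (-1 : ℝ) ^ (m + 1) * (expSum (m + (k + 1)) - expSum m) = |expTerm (m + 1)| -
        (-1 : ℝ) ^ (m + 1 + 1) * (expSum (m + 1 + k) - expSum (m + 1)) := by
      rw [← hs, show m + (k + 1) = m + 1 + k by ring, expSum_succ m]
      ring
    rw [key]
    exact ⟨by linarith, by linarith⟩

theorem expSum_le_of_even {m n : ℕ} (hm : Even m) (h : m ≤ n) : expSum n ≤ expSum m := by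
  obtain ⟨k, rfl⟩ := Nat.exists_eq_add_of_le h
  have h0 := (expSum_sub_mem_Icc m k).1
  rw [hm.add_one.neg_one_pow] at h0
  linarith

theorem le_expSum_of_odd {m n : ℕ} (hm : Odd m) (h : m ≤ n) : expSum m ≤ expSum n := by
  obtain ⟨k, rfl⟩ := Nat.exists_eq_add_of_le h
  have h0 := (expSum_sub_mem_Icc m k).1
  rw [hm.add_one.neg_one_pow] at h0
  linarith

theorem expSum_one : expSum 1 = -1 := by
  norm_num [expSum, expTerm, Finset.sum_range_succ, Nat.factorial]

theorem expSum_two : expSum 2 = 1 := by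
  norm_num [expSum, expTerm, Finset.sum_range_succ, Nat.factorial]

theorem expSum_three : expSum 3 = -1 / 3 := by
  norm_num [expSum, expTerm, Finset.sum_range_succ, Nat.factorial]

theorem expSum_four : expSum 4 = 1 / 3 := by
  norm_num [expSum, expTerm, Finset.sum_range_succ, Nat.factorial]

theorem expSum_five : expSum 5 = 1 / 15 := by
  norm_num [expSum, expTerm, Finset.sum_range_succ, Nat.factorial]

theorem expSum_six : expSum 6 = 7 / 45 := by
  norm_num [expSum, expTerm, Finset.sum_range_succ, Nat.factorial]

theorem expSum_add_succ_nonneg (m : ℕ) : 0 ≤ expSum m + expSum (m + 1) := by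
  rcases Nat.lt_or_ge m 5 with h | h
  · interval_cases m <;>
      norm_num [expSum_zero, expSum_one, expSum_two, expSum_three, expSum_four, expSum_five]
  · have h1 := le_expSum_of_odd (m := 5) (by decide) h
    have h2 := le_expSum_of_odd (m := 5) (n := m + 1) (by decide) (by omega)
    rw [expSum_five] at h1 h2
    linarith

theorem weightedQ_zero : weightedQ 0 = 0 := by
  norm_num [weightedQ, expTerm_zero, expSum_zero]

theorem weightedQ_succ (m : ℕ) :
    weightedQ (m + 1) = weightedQ m + (1 + expSum (m + 1)) / 2 := by
  have h := succ_mul_expTerm_succ m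
  simp only [weightedQ, expSum_succ]
  push_cast
  linear_combination h / 2

/-- The contribution of the part `a` to the superadditivity defect of `weightedQ`. -/
theorem neg_abs_expTerm_le_defect (a k : ℕ) :
    -|expTerm (a + 2)| ≤
      ((a : ℝ) + 3) * (expSum (a + 2 + k) - expSum a) + 2 * expTerm a := by
  obtain ⟨h0, h1⟩ := expSum_sub_mem_Icc (a + 2) k
  have e1 := succ_mul_expTerm_succ a
  have e2 := succ_mul_expTerm_succ (a + 1)
  have e3 := abs_expTerm_succ (a + 2)
  have es := expTerm_eq_neg_one_pow_mul_abs (a + 2)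
  push_cast at e2 e3
  have key : ((a : ℝ) + 3) * (expSum (a + 2 + k) - expSum a) + 2 * expTerm a =
      expTerm (a + 2) + ((a : ℝ) + 3) * (expSum (a + 2 + k) - expSum (a + 2)) := by
    rw [expSum_succ (a + 1), expSum_succ a]
    linear_combination e1 + e2
  have hv := mul_le_mul_of_nonneg_left h1 (by positivity : (0 : ℝ) ≤ (a : ℝ) + 3)
  have hv0 := mul_nonneg (by positivity : (0 : ℝ) ≤ (a : ℝ) + 3) h0
  rw [key]
  rcases Nat.even_or_odd a with ha | ha
  · have hp : (-1 : ℝ) ^ (a + 2) = 1 := (ha.add (by decide)).neg_one_pow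
    rw [pow_succ, hp] at hv hv0
    rw [hp] at es
    linarith
  · have hp : (-1 : ℝ) ^ (a + 2) = -1 := (ha.add_even (by decide)).neg_one_pow
    rw [pow_succ, hp] at hv hv0
    rw [hp] at es
    linarith

theorem weightedQ_add_le_of_four_le {a b : ℕ} (ha : 4 ≤ a) (hb : 4 ≤ b) :
    weightedQ a + weightedQ b ≤ weightedQ (a + b) := by
  have hda := neg_abs_expTerm_le_defect a (b - 2)
  have hdb := neg_abs_expTerm_le_defect b (a - 2)
  rw [show a + 2 + (b - 2) = a + b by omega] at hda
  rw [show b + 2 + (a - 2) = a + b by omega] at hdb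
  have h6 : |expTerm 6| = 4 / 45 := by norm_num [expTerm, Nat.factorial]
  have ta := abs_expTerm_le_of_le (m := 6) (n := a + 2) (by omega) (by omega)
  have tb := abs_expTerm_le_of_le (m := 6) (n := b + 2) (by omega) (by omega)
  have tn := abs_expTerm_le_of_le (m := 6) (n := a + b) (by omega) (by omega)
  have sn := expSum_le_of_even (m := 6) (n := a + b) (by decide) (by omega)
  have tn' := le_abs_self (expTerm (a + b))
  rw [h6] at ta tb tn
  rw [expSum_six] at sn
  have key : 2 * (weightedQ (a + b) - weightedQ a - weightedQ b) =
      1 - 3 * expSum (a + b) - 2 * expTerm (a + b) +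
        (((a : ℝ) + 3) * (expSum (a + b) - expSum a) + 2 * expTerm a) +
        (((b : ℝ) + 3) * (expSum (a + b) - expSum b) + 2 * expTerm b) := by
    simp only [weightedQ]
    push_cast
    ring
  linarith

theorem weightedQ_add_le_of_lt_four (a : ℕ) {b : ℕ} (hb : b < 4) :
    weightedQ a + weightedQ b ≤ weightedQ (a + b) := by
  have u1 := expSum_add_succ_nonneg (a + 1)
  have s1 : -1 ≤ expSum (a + 1) := by
    simpa [expSum_one] using le_expSum_of_odd (m := 1) (n := a + 1) (by decide) (by omega)
  have s3 : -1 / 3 ≤ expSum (a + 3) := by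
    simpa [expSum_three] using le_expSum_of_odd (m := 3) (n := a + 3) (by decide) (by omega)
  have q1 := weightedQ_succ 0
  have q2 := weightedQ_succ 1
  have q3 := weightedQ_succ 2
  have r1 := weightedQ_succ a
  have r2 := weightedQ_succ (a + 1)
  have r3 := weightedQ_succ (a + 2)
  norm_num [weightedQ_zero, expSum_one, expSum_two, expSum_three] at q1 q2 q3
  interval_cases b
  · simp [weightedQ_zero]
  all_goals simp only [add_assoc, Nat.reduceAdd] at *; linarith

theorem weightedQ_superadditive (a b : ℕ) :
    weightedQ a + weightedQ b ≤ weightedQ (a + b) := by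
  rcases Nat.lt_or_ge b 4 with hb | hb
  · exact weightedQ_add_le_of_lt_four a hb
  rcases Nat.lt_or_ge a 4 with ha | ha
  · rw [add_comm a b, add_comm (weightedQ a)]
    exact weightedQ_add_le_of_lt_four b ha
  · exact weightedQ_add_le_of_four_le ha hb

theorem mul_pathQ_s13 (m : ℕ) : (m : ℝ) * pathQ m = weightedQ m := by
  rcases Nat.eq_zero_or_pos m with rfl | hm
  · simp [weightedQ_zero]
  · have : (m : ℝ) ≠ 0 := by positivity
    simp only [pathQ, if_neg hm.ne', weightedQ, expSum, expTerm]
    field_simp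

theorem pathP_succ (m : ℕ) : pathP (m + 1) = (1 + weightedQ m) / ((m + 1 : ℕ) : ℝ) := by
  have h0 : (m : ℝ) + 1 ≠ 0 := by positivity
  have h := succ_mul_expTerm_succ m
  have hP : pathP (m + 1) = 1 / 2 - 1 / ((m + 1 : ℕ) : ℝ) * expTerm (m + 1) +
      (((m + 1 : ℕ) : ℝ) + 2) / (2 * ((m + 1 : ℕ) : ℝ)) * expSum (m + 1) := rfl
  rw [hP, weightedQ, expSum_succ]
  push_cast
  field_simp
  linear_combination h

/-- The value of choosing the vertex with `k - 1` vertices on one side and `n - k` on the other. -/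
theorem pathQ_split_eq (n k : ℕ) (hk : 1 ≤ k) (hkn : k ≤ n) :
    1 / (n : ℝ) + (((k : ℝ) - 1) / (n : ℝ)) * pathQ (k - 1) +
        (((n : ℝ) - (k : ℝ)) / (n : ℝ)) * pathQ (n - k) =
      (1 + (weightedQ (k - 1) + weightedQ (n - k))) / (n : ℝ) := by
  rw [← mul_pathQ_s13, ← mul_pathQ_s13, Nat.cast_sub hk, Nat.cast_sub hkn, Nat.cast_one]
  ring


theorem stmt_13 (n : ℕ) (hn : 1 ≤ n) :
    pathP n = (Finset.Icc 1 n).sup' (Finset.nonempty_Icc.mpr hn) (fun k =>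
      1 / (n : ℝ) + (((k : ℝ) - 1) / (n : ℝ)) * pathQ (k - 1) +
        (((n : ℝ) - (k : ℝ)) / (n : ℝ)) * pathQ (n - k)) := by
  have hP : pathP n = (1 + weightedQ (n - 1)) / (n : ℝ) := by
    obtain ⟨m, rfl⟩ := Nat.exists_eq_add_of_le' hn
    exact pathP_succ m
  apply le_antisymm
  · refine le_trans (le_of_eq ?_) (Finset.le_sup' _ (Finset.mem_Icc.mpr ⟨le_rfl, hn⟩))
    rw [pathQ_split_eq n 1 le_rfl hn, hP, Nat.sub_self, weightedQ_zero, zero_add]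
  · refine Finset.sup'_le _ _ fun k hk => ?_
    obtain ⟨hk, hkn⟩ := Finset.mem_Icc.mp hk
    rw [pathQ_split_eq n k hk hkn, hP]
    have h := weightedQ_superadditive (k - 1) (n - k)
    rw [show k - 1 + (n - k) = n - 1 by omega] at h
    gcongr
end

section
/- Define for each positive integer n the real number Q_n = 2/3 − 2/(3n) + (2/(3n))·(binom(n, n/2)/2^n) if n is even and Q_n = 2/3 − 2/(3n) if n is odd. Then for all positive integers m and n, m·Q_m + n·Q_n ≤ (m+n)·Q_{m+n}; that is, the sequence (n·Q_n) is superadditive. -/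
theorem two_mul_choose_half_le_two_pow {n : ℕ} (hn : n ≠ 0) (he : Even n) :
    2 * n.choose (n / 2) ≤ 2 ^ n := by
  obtain ⟨k, rfl⟩ := he
  obtain ⟨j, rfl⟩ : ∃ j, k = j + 1 := ⟨k - 1, by omega⟩
  have hj : (j + 1 + (j + 1)) / 2 = j + 1 := by omega
  have hpow : 2 ^ (2 * j + 1 + 1) = 4 * 4 ^ j := by
    rw [add_assoc, pow_add, pow_mul]
    norm_num [mul_comm]
  rw [hj, show j + 1 + (j + 1) = 2 * j + 1 + 1 by ring, hpow, Nat.choose_succ_succ,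
    Nat.succ_eq_add_one, Nat.choose_symm_half]
  have := Nat.choose_middle_le_pow j
  omega

/-- The excess of `n * starQ n` over its linear part lies between `0` and `1 / 3`. -/
theorem mul_starQ_bounds {n : ℕ} (hn : n ≠ 0) :
    2 / 3 * (n : ℝ) - 2 / 3 ≤ n * starQ n ∧ n * starQ n ≤ 2 / 3 * (n : ℝ) - 1 / 3 := by
  have hn' : (n : ℝ) ≠ 0 := Nat.cast_ne_zero.mpr hn
  have hlin : (n : ℝ) * (2 / 3 - 2 / (3 * n)) = 2 / 3 * n - 2 / 3 := by
    field_simp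
  rw [starQ, mul_add, hlin]
  split_ifs with he
  · have hc : (n : ℝ) * (2 / (3 * n) * ((n.choose (n / 2) : ℝ) / 2 ^ n)) =
        2 / 3 * ((n.choose (n / 2) : ℝ) / 2 ^ n) := by
      field_simp
    have hpos : (0 : ℝ) ≤ (n.choose (n / 2) : ℝ) / 2 ^ n := by positivity
    have hhalf : (n.choose (n / 2) : ℝ) / 2 ^ n ≤ 1 / 2 := by
      have h : (2 : ℝ) * n.choose (n / 2) ≤ 2 ^ n := by
        exact_mod_cast two_mul_choose_half_le_two_pow hn he
      rw [div_le_iff₀ (by positivity)]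
      linarith
    rw [hc]
    constructor <;> linarith
  · constructor <;> linarith

theorem stmt_15 (m n : ℕ) (hm : 1 ≤ m) (hn : 1 ≤ n) :
    (m : ℝ) * starQ m + (n : ℝ) * starQ n ≤ ((m : ℝ) + (n : ℝ)) * starQ (m + n) := by
  have hsum := (mul_starQ_bounds (n := m + n) (by omega)).1
  push_cast at hsum
  linarith [(mul_starQ_bounds (n := m) (by omega)).2, (mul_starQ_bounds (n := n) (by omega)).2]
end

section
/- Let G be a finite tree with vertex set V, where |V| = n ≥ 4. Suppose P and Q each assign a real number to every nonempty subset S ⊆ V whose induced subgraph is connected (hence a subtree of G), satisfying for every such S: P(S) = max over v ∈ S of [1/|S| + (1/|S|)·Σ_C |C|·Q(C)] and Q(S) = (1/|S|²)·Σ_{v ∈ S} Σ_C |C|·P(C), where C ranges over the vertex sets of the connected components of the subgraph of G induced on S ∖ {v}. Then P(V) > 9/16 and Q(V) ≥ 9/16 − 5/(16n). -/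
open Finset Relation

/-- A lower bound for `48 * (k * P - 9 * k / 16)` on subtrees with `k` vertices. -/
def firstExcess (k : ℕ) : ℤ :=
  if k = 0 then 0 else if k = 1 then 21 else if k = 2 then -6 else if k = 3 then 15
  else if k = 4 then 4 else if k = 5 then 9 else 6

theorem firstExcess_pos {k : ℕ} (hk : 3 ≤ k) : 0 < firstExcess k := by
  unfold firstExcess
  grind

theorem six_le_firstExcess {k : ℕ} (hk : 5 ≤ k) : 6 ≤ firstExcess k := by
  unfold firstExcess
  grind

/-- A lower bound for the contribution of an edge that splits a tree on `n` vertices into parts with `k` and `n - k`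
vertices. -/
def edgeExcess (n k : ℕ) : ℤ := firstExcess k + firstExcess (n - k) - 12

/-- A lower bound for the total contribution of the edges of a rooted forest with `m` vertices that
hangs at a vertex of a tree on `n` vertices. -/
def forestExcess (n m : ℕ) : ℤ :=
  if n ≤ 8 then
    ([[], [0], [0, 30], [0, 3, 6], [0, 24, 0, 24], [0, 13, 10, 7, 20], [0, 18, 4, 22, 8, 26],
      [0, 15, 6, 13, 12, 3, 18], [0, 15, 3, 15, 6, 18, 6, 21]].getD n []).getD m 0
  else if m = 0 then 0 else if m = 1 then 15 else if m = 2 then 3 else if m = 3 then 12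
  else if m = 4 then 6 else if m + 1 = n then 12 else if m + 2 = n then -3
  else if m + 4 = n then 7 else 9

theorem forestExcess_of_lt {n : ℕ} (h : ¬ n ≤ 8) (m : ℕ) :
    forestExcess n m =
      if m = 0 then 0 else if m = 1 then 15 else if m = 2 then 3 else if m = 3 then 12
      else if m = 4 then 6 else if m + 1 = n then 12 else if m + 2 = n then -3
      else if m + 4 = n then 7 else 9 := by
  rw [forestExcess, if_neg h]

theorem forestExcess_zero (n : ℕ) : forestExcess n 0 = 0 := by
  by_cases h : n ≤ 8
  · interval_cases n <;> decide
  · rw [forestExcess_of_lt h, if_pos rfl]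

theorem forestExcess_add_le {n a b : ℕ} (ha : 1 ≤ a) (hab : a + b < n) :
    forestExcess n (a + b) ≤ edgeExcess n a + forestExcess n (a - 1) + forestExcess n b := by
  by_cases h : n ≤ 8
  · have key : ∀ n : Fin 9, ∀ a b : Fin 9, 1 ≤ a.1 → a.1 + b.1 < n.1 →
        forestExcess n (a + b : ℕ) ≤
          edgeExcess n a + forestExcess n (a - 1 : ℕ) + forestExcess n b := by
      decide
    exact key ⟨n, by omega⟩ ⟨a, by omega⟩ ⟨b, by omega⟩ ha hab
  · have h5 : a = 1 ∨ a = 2 ∨ a = 3 ∨ a = 4 ∨ a = 5 ∨ 6 ≤ a := by omega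
    have h6 : b = 0 ∨ b = 1 ∨ b = 2 ∨ b = 3 ∨ b = 4 ∨ 5 ≤ b := by omega
    rw [forestExcess_of_lt h, forestExcess_of_lt h, forestExcess_of_lt h]
    unfold edgeExcess firstExcess
    rcases h5 with rfl | rfl | rfl | rfl | rfl | h5 <;>
    rcases h6 with rfl | rfl | rfl | rfl | rfl | h6 <;>
    grind (splits := 40)

theorem le_forestExcess {n : ℕ} (hn : 1 ≤ n) :
    12 + n * (firstExcess (n + 1) - 6) ≤ forestExcess n (n - 1) := by
  by_cases h : n ≤ 8
  · interval_cases n <;> decide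
  · rw [forestExcess_of_lt h]
    unfold firstExcess
    grind (splits := 40)

/-- The lower bound for `k * P` on subtrees with `k` vertices. -/
noncomputable def firstBound (k : ℕ) : ℝ := (27 * k + firstExcess k) / 48

theorem firstBound_mono : Monotone firstBound := by
  refine monotone_nat_of_le_succ fun k => ?_
  have h : 27 * (k : ℤ) + firstExcess k ≤ 27 * ((k + 1 : ℕ) : ℤ) + firstExcess (k + 1) := by
    simp only [firstExcess]
    push_cast
    split_ifs <;> omega
  have h' : 27 * (k : ℝ) + firstExcess k ≤ 27 * ((k + 1 : ℕ) : ℝ) + firstExcess (k + 1) := by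
    exact_mod_cast h
  unfold firstBound
  linarith

theorem firstBound_nonneg (k : ℕ) : 0 ≤ firstBound k := by
  have : firstBound 0 = 0 := by simp [firstBound, firstExcess]
  exact this ▸ firstBound_mono (Nat.zero_le k)

/-- The parent function `par` and the depth function `dep` describe `H` as a tree with root `r`. -/
structure IsRooting {α : Type*} (H : SimpleGraph α) (r : α) (par : α → α) (dep : α → ℕ) : Prop where
  dep_par : ∀ v, v ≠ r → dep v = dep (par v) + 1
  adj_par : ∀ v, v ≠ r → H.Adj (par v) v
  of_adj : ∀ u v, H.Adj u v → (u ≠ r ∧ par u = v) ∨ (v ≠ r ∧ par v = u)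

theorem SimpleGraph.IsTree.exists_isRooting {α : Type*} {H : SimpleGraph α} (hH : H.IsTree)
    (r : α) : ∃ par dep, IsRooting H r par dep := by
  have hc := hH.connected
  choose p hp hlen using fun v => hc.exists_path_of_dist r v
  have up : ∀ u v, H.Adj u v → H.dist r v = H.dist r u + 1 → (p v).penultimate = u := by
    intro u v huv hd
    have hq : ((p u).concat huv).IsPath := by
      refine SimpleGraph.Walk.isPath_of_length_eq_dist _ ?_
      rw [SimpleGraph.Walk.length_concat, hlen, hd]
    have := (hH.isAcyclic.subsingleton_path r v).elim ⟨_, hp v⟩ ⟨_, hq⟩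
    rw [Subtype.mk.injEq] at this
    rw [this]
    simp
  have step : ∀ u v, H.Adj u v → H.dist r v = H.dist r u + 1 ∨ H.dist r u = H.dist r v + 1 := by
    intro u v huv
    have h1 := hH.dist_ne_of_adj r huv
    have h2 := huv.diff_dist_adj (u := r)
    omega
  have nn : ∀ v, v ≠ r → ¬ (p v).Nil := fun v hv =>
    SimpleGraph.Walk.not_nil_of_ne (Ne.symm hv)
  refine ⟨fun v => (p v).penultimate, H.dist r, fun v hv => ?_, fun v hv => ?_, ?_⟩
  · have ha := (p v).adj_penultimate (nn v hv)
    have hl : H.dist r (p v).penultimate ≤ (p v).dropLast.length := SimpleGraph.dist_le _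
    have h3 : (p v).dropLast.length + 1 = (p v).length := by
      have := (p v).length_dropLast_add_one (nn v hv)
      simpa using this
    rw [hlen] at h3
    have := step _ _ ha
    omega
  · exact (p v).adj_penultimate (nn v hv)
  · intro u v huv
    rcases step u v huv with h | h
    · refine Or.inr ⟨?_, up u v huv h⟩
      rintro rfl
      simp at h
    · refine Or.inl ⟨?_, up v u huv.symm h⟩
      rintro rfl
      simp at h

/-- `w` is a descendant of `v` in the tree with root `r` and parent function `par`. -/
def Desc {α : Type*} (r : α) (par : α → α) (v w : α) : Prop :=
  ReflTransGen (fun a b => b ≠ r ∧ par b = a) v w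

namespace IsRooting

variable {α : Type*} {H : SimpleGraph α} {r : α} {par : α → α} {dep : α → ℕ}

theorem dep_le (h : IsRooting H r par dep) {v w : α} (hvw : Desc r par v w) :
    dep v ≤ dep w ∧ (dep v = dep w → v = w) := by
  induction hvw with
  | refl => simp
  | tail _ hbc ih =>
    obtain ⟨h1, rfl⟩ := hbc
    have := h.dep_par _ h1
    exact ⟨by omega, by omega⟩

theorem desc_unique (h : IsRooting H r par dep) {u u' w : α} (hu : Desc r par u w)
    (hu' : Desc r par u' w) (hd : dep u = dep u') : u = u' := by
  induction hu with
  | refl => exact ((h.dep_le hu').2 hd.symm).symm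
  | tail hab hbc ih =>
    obtain ⟨h1, rfl⟩ := hbc
    have h2 := h.dep_par _ h1
    rcases ReflTransGen.cases_tail hu' with h3 | ⟨d, hd1, hd2, rfl⟩
    · have := (h.dep_le hab).1
      subst h3
      omega
    · exact ih hd1

theorem dep_child (h : IsRooting H r par dep) {v u : α} (hu : u ≠ r ∧ par u = v) :
    dep u = dep v + 1 := by
  have := h.dep_par u hu.1
  rw [this, hu.2]

theorem desc_iff {v w : α} :
    Desc r par v w ↔ w = v ∨ ∃ u, (u ≠ r ∧ par u = v) ∧ Desc r par u w := by
  unfold Desc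
  rw [ReflTransGen.cases_head_iff]
  exact or_congr_left eq_comm

theorem not_desc_child (h : IsRooting H r par dep) {v u : α} (hu : u ≠ r ∧ par u = v) :
    ¬ Desc r par u v := by
  intro hd
  have := (h.dep_le hd).1
  have := h.dep_child hu
  omega

theorem desc_root (h : IsRooting H r par dep) (w : α) : Desc r par r w := by
  induction hn : dep w using Nat.strong_induction_on generalizing w with
  | _ n ih =>
    by_cases hw : w = r
    · subst hw; exact ReflTransGen.refl
    · have := h.dep_par w hw
      exact ReflTransGen.tail (ih _ (by omega) (par w) rfl) ⟨hw, rfl⟩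

theorem desc_root_right (h : IsRooting H r par dep) {u : α} (hu : Desc r par u r) : u = r := by
  have h1 := h.dep_le hu
  have h2 := h.dep_le (h.desc_root u)
  exact h1.2 (by omega)

variable [Fintype α]

open Classical in
/-- The set of descendants of `v`. -/
noncomputable def desc (r : α) (par : α → α) (v : α) : Finset α := univ.filter (Desc r par v)

open Classical in
/-- The set of children of `v`. -/
noncomputable def children (r : α) (par : α → α) (v : α) : Finset α :=
  univ.filter fun u => u ≠ r ∧ par u = v

open Classical in
theorem sum_desc (h : IsRooting H r par dep) {M : Type*} [AddCommMonoid M] (g : α → M) (v : α) :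
    ∑ w ∈ desc r par v, g w = g v + ∑ u ∈ children r par v, ∑ w ∈ desc r par u, g w := by
  have hdis : Set.PairwiseDisjoint (children r par v : Set α) (desc r par) := by
    intro u hu u' hu' hne
    simp only [children, coe_filter, mem_univ, true_and, Set.mem_ofPred_eq] at hu hu'
    refine Finset.disjoint_left.2 fun w hw hw' => hne ?_
    simp only [desc, mem_filter, mem_univ, true_and] at hw hw'
    exact h.desc_unique hw hw' (by rw [h.dep_child hu, h.dep_child hu'])
  rw [← Finset.sum_biUnion hdis, ← Finset.sum_insert]
  · refine Finset.sum_congr ?_ fun _ _ => rfl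
    ext w
    simp only [desc, children, mem_filter, mem_univ, true_and, mem_insert, mem_biUnion]
    exact desc_iff
  · simp only [desc, children, mem_filter, mem_univ, true_and, mem_biUnion, not_exists, not_and]
    exact fun u hu => h.not_desc_child hu

theorem card_desc (h : IsRooting H r par dep) (v : α) :
    (desc r par v).card = 1 + ∑ u ∈ children r par v, (desc r par u).card := by
  simpa using h.sum_desc (fun _ => (1 : ℕ)) v

theorem forestExcess_sum_le {ι : Type*} {n : ℕ} (K : Finset ι) (d : ι → ℕ) (hd : ∀ i ∈ K, 1 ≤ d i)
    (hK : ∑ i ∈ K, d i < n) :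
    forestExcess n (∑ i ∈ K, d i) ≤
      ∑ i ∈ K, (edgeExcess n (d i) + forestExcess n (d i - 1)) := by
  classical
  induction K using Finset.induction_on with
  | empty => simp [forestExcess_zero]
  | insert a s ha ih =>
    rw [Finset.sum_insert ha] at hK
    rw [Finset.sum_insert ha, Finset.sum_insert ha]
    have h1 := ih (fun i hi => hd i (mem_insert_of_mem hi)) (by omega)
    have h2 := forestExcess_add_le (hd a (mem_insert_self _ _)) hK
    linarith

theorem forestExcess_le_sum_desc (h : IsRooting H r par dep) (v : α) :
    forestExcess (Fintype.card α) ((desc r par v).card - 1) ≤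
      ∑ u ∈ children r par v, ∑ w ∈ desc r par u,
        edgeExcess (Fintype.card α) (desc r par w).card := by
  induction hn : (desc r par v).card using Nat.strong_induction_on generalizing v with
  | _ m ih =>
    have hc := h.card_desc v
    have hle : (desc r par v).card ≤ Fintype.card α := Finset.card_le_univ _
    have h1 : ∀ u ∈ children r par v, 1 ≤ (desc r par u).card := fun u _ => by
      have := h.card_desc u
      omega
    have h2 := forestExcess_sum_le (n := Fintype.card α) (children r par v)
      (fun u => (desc r par u).card) h1 (by omega)
    rw [show m - 1 = ∑ u ∈ children r par v, (desc r par u).card by omega]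
    refine h2.trans (Finset.sum_le_sum fun u hu => ?_)
    rw [h.sum_desc _ u]
    have h3 : (desc r par u).card ≤ ∑ u ∈ children r par v, (desc r par u).card :=
      Finset.single_le_sum (f := fun u => (desc r par u).card) (fun _ _ => Nat.zero_le _) hu
    have := ih _ (by omega) u rfl
    linarith

open Classical in
theorem forestExcess_le_sum (h : IsRooting H r par dep) :
    forestExcess (Fintype.card α) (Fintype.card α - 1) ≤
      ∑ w ∈ univ.erase r, edgeExcess (Fintype.card α) (desc r par w).card := by
  have h1 := h.forestExcess_le_sum_desc r
  have hr : desc r par r = univ := by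
    ext w
    simpa [desc] using h.desc_root w
  have h2 := h.sum_desc (fun w => edgeExcess (Fintype.card α) (desc r par w).card) r
  rw [hr] at h1 h2
  rw [Finset.card_univ] at h1
  have h3 := Finset.add_sum_erase univ
    (fun w => edgeExcess (Fintype.card α) (desc r par w).card) (mem_univ r)
  simp only [hr] at h3
  linarith

open Classical in
/-- Deleting `v` leaves a component for each child of `v`, and one more if `v` is not the root. -/
theorem sum_le_sum_component (h : IsRooting H r par dep) {β : Type*} [Finite β] {K : SimpleGraph β}
    (e : K ↪g H) (v : α) (he : ∀ w, w ≠ v ↔ ∃ b, e b = w) {F : ℕ → ℝ} (hF : Monotone F)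
    (hF0 : ∀ k, 0 ≤ F k) :
    ∑ u ∈ children r par v, F (desc r par u).card +
        (if v = r then 0 else F (Fintype.card α - (desc r par v).card)) ≤
      ∑ᶠ c : K.ConnectedComponent, F c.supp.ncard := by
  have hadj : ∀ a b, H.Adj (e a) (e b) → K.Adj a b := fun a b => e.map_adj_iff.1
  have hne : ∀ b, e b ≠ v := fun b => (he _).2 ⟨b, rfl⟩
  -- A component of the complement of `v` cannot leave the descendants of a child of `v`.
  have inv : ∀ u, (u ≠ r ∧ par u = v) → ∀ a b, K.Reachable a b →
      Desc r par u (e a) → Desc r par u (e b) := by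
    intro u hu a b hab
    obtain ⟨p⟩ := hab
    induction p with
    | nil => exact id
    | @cons x y z hxy _ ih =>
      intro hx
      refine ih ?_
      rcases h.of_adj _ _ (e.map_adj_iff.2 hxy) with h1 | h1
      · rcases ReflTransGen.cases_tail hx with h2 | ⟨d, hd1, hd2, hd3⟩
        · exact absurd (h1.2.symm.trans ((congrArg par h2).trans hu.2)) (hne y)
        · rw [← h1.2, hd3]; exact hd1
      · exact ReflTransGen.tail hx h1
  have down : ∀ u, (u ≠ r ∧ par u = v) → ∀ a, e a = u → ∀ w, Desc r par u w →
      ∃ b, e b = w ∧ K.Reachable a b := by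
    intro u hu a ha w hw
    induction hw with
    | refl => exact ⟨a, ha, .refl _⟩
    | @tail x y hux hxy ih =>
      obtain ⟨b, hb, hab⟩ := ih
      have huy : Desc r par u y := ReflTransGen.tail hux hxy
      obtain ⟨b', hb'⟩ := (he y).1 (fun hy => h.not_desc_child hu (hy ▸ huy))
      refine ⟨b', hb', hab.trans (hadj _ _ ?_).reachable⟩
      rw [hb, hb', ← hxy.2]
      exact h.adj_par y hxy.1
  have up : ∀ a, e a = r → ∀ w, ¬ Desc r par v w → ∃ b, e b = w ∧ K.Reachable a b := by
    intro a ha w hw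
    induction h.desc_root w with
    | refl => exact ⟨a, ha, .refl _⟩
    | @tail x y _ hxy ih =>
      obtain ⟨b, hb, hab⟩ := ih (fun hx => hw (ReflTransGen.tail hx hxy))
      obtain ⟨b', hb'⟩ := (he y).1 (fun hy => hw (hy ▸ ReflTransGen.refl))
      refine ⟨b', hb', hab.trans (hadj _ _ ?_).reachable⟩
      rw [hb, hb', ← hxy.2]
      exact h.adj_par y hxy.1
  have card_le : ∀ (a : β) (s : Finset α), (∀ w ∈ s, ∃ b, e b = w ∧ K.Reachable a b) →
      s.card ≤ (K.connectedComponentMk a).supp.ncard := by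
    intro a s hs
    rw [← Set.ncard_coe_finset, ← Set.ncard_image_of_injective _ e.injective]
    refine Set.ncard_le_ncard (fun w hw => ?_) (Set.toFinite _)
    obtain ⟨b, hb, hab⟩ := hs w hw
    exact ⟨b, SimpleGraph.ConnectedComponent.sound hab.symm, hb⟩
  set R := (children r par v) ∪ (if v = r then ∅ else {r}) with hR
  have memR : ∀ u, u ∈ R → (u ≠ r ∧ par u = v) ∨ (u = r ∧ v ≠ r) := by
    intro u hu
    rw [hR, mem_union] at hu
    rcases hu with hu | hu
    · left; simpa [children] using hu
    · right
      split_ifs at hu with hv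
      · simp at hu
      · exact ⟨by simpa using hu, hv⟩
  have ex : ∀ u : R, ∃ b, e b = u := by
    rintro ⟨u, hu⟩
    refine (he u).1 ?_
    rcases memR u hu with hu | hu
    · rintro rfl
      exact h.not_desc_child hu ReflTransGen.refl
    · rw [hu.1]; exact hu.2.symm
  choose a ha using ex
  have hinj : Function.Injective fun u : R => K.connectedComponentMk (a u) := by
    have key : ∀ u u' : R, ((u : α) ≠ r ∧ par u = v) →
        K.connectedComponentMk (a u) = K.connectedComponentMk (a u') → u = u' := by
      intro u u' hu huu
      have h1 := inv u hu _ _ (SimpleGraph.ConnectedComponent.exact huu)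
        (by rw [ha]; exact ReflTransGen.refl)
      rw [ha] at h1
      rcases memR u' u'.2 with hu' | hu'
      · refine Subtype.ext ((h.dep_le h1).2 ?_)
        rw [h.dep_child hu, h.dep_child hu']
      · rw [hu'.1] at h1
        exact absurd (h.desc_root_right h1) hu.1
    intro u u' huu
    rcases memR u u.2 with hu | hu
    · exact key u u' hu huu
    · rcases memR u' u'.2 with hu' | hu'
      · exact (key u' u hu' huu.symm).symm
      · exact Subtype.ext (hu.1.trans hu'.1.symm)
  have : Fintype K.ConnectedComponent := Fintype.ofFinite _
  rw [finsum_eq_sum_of_fintype]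
  set sz : α → ℕ := fun u => if u = r then Fintype.card α - (desc r par v).card
    else (desc r par u).card with hsz
  have hsz_le : ∀ u : R, sz u ≤ (K.connectedComponentMk (a u)).supp.ncard := by
    intro u
    rcases memR u u.2 with hu | hu
    · rw [hsz]
      simp only [if_neg hu.1]
      refine card_le _ _ fun w hw => down u hu _ (ha u) w (by simpa [desc] using hw)
    · rw [hsz]
      simp only [if_pos hu.1]
      rw [← Finset.card_compl]
      refine card_le _ _ fun w hw => up _ ((ha u).trans hu.1) w (by simpa [desc] using hw)
  calc _ = ∑ u ∈ R, F (sz u) := by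
        rw [hR, Finset.sum_union]
        · congr 1
          · refine Finset.sum_congr rfl fun u hu => ?_
            simp only [children, mem_filter, mem_univ, true_and] at hu
            simp [hsz, hu.1]
          · split_ifs <;> simp [hsz]
        · split_ifs <;> simp [children]
    _ = ∑ u : R, F (sz u) := (Finset.sum_coe_sort R fun u => F (sz u)).symm
    _ ≤ ∑ u : R, F (K.connectedComponentMk (a u)).supp.ncard :=
        Finset.sum_le_sum fun u _ => hF (hsz_le u)
    _ = ∑ c ∈ univ.image (fun u : R => K.connectedComponentMk (a u)), F c.supp.ncard := by
        rw [Finset.sum_image fun u _ u' _ huu => hinj huu]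
    _ ≤ _ := Finset.sum_le_univ_sum_of_nonneg fun c => hF0 _

open Classical in
theorem sum_children (g : α → ℝ) :
    ∑ v, ∑ u ∈ children r par v, g u = ∑ u ∈ univ.erase r, g u := by
  rw [← Finset.sum_fiberwise (univ.erase r) par]
  refine Finset.sum_congr rfl fun v _ => Finset.sum_congr ?_ fun _ _ => rfl
  ext u
  simp [children]

end IsRooting

open Classical in
theorem sum_component_lower_bound {α : Type*} [Fintype α] {H : SimpleGraph α} (hH : H.IsTree)
    (f : α → ℝ)
    (hf : ∀ v, ∃ (β : Type _) (_ : Finite β) (K : SimpleGraph β) (e : K ↪g H),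
      (∀ w, w ≠ v ↔ ∃ b, e b = w) ∧
        ∑ᶠ c : K.ConnectedComponent, firstBound c.supp.ncard ≤ f v) :
    Fintype.card α * (firstBound (Fintype.card α + 1) - 1) ≤ ∑ v, f v := by
  obtain ⟨r⟩ := hH.connected.nonempty
  obtain ⟨par, dep, h⟩ := hH.exists_isRooting r
  set n := Fintype.card α with hn
  have hn1 : 1 ≤ n := Fintype.card_pos_iff.2 ⟨r⟩
  have h1 : ∀ v, ∑ u ∈ IsRooting.children r par v, firstBound (IsRooting.desc r par u).card +
      (if v = r then 0 else firstBound (n - (IsRooting.desc r par v).card)) ≤ f v := by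
    intro v
    obtain ⟨β, _, K, e, he, hle⟩ := hf v
    exact (h.sum_le_sum_component e v he firstBound_mono firstBound_nonneg).trans hle
  have h2 := Finset.sum_le_sum fun v (_ : v ∈ univ) => h1 v
  rw [Finset.sum_add_distrib, IsRooting.sum_children] at h2
  have h3 : ∑ v, (if v = r then 0 else firstBound (n - (IsRooting.desc r par v).card)) =
      ∑ v ∈ univ.erase r, firstBound (n - (IsRooting.desc r par v).card) := by
    rw [← Finset.add_sum_erase univ _ (mem_univ r), if_pos rfl, zero_add]
    exact Finset.sum_congr rfl fun v hv => if_neg (Finset.ne_of_mem_erase hv)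
  rw [h3, ← Finset.sum_add_distrib] at h2
  refine le_trans ?_ h2
  have h4 : ∀ v ∈ univ.erase r, firstBound (IsRooting.desc r par v).card +
      firstBound (n - (IsRooting.desc r par v).card) =
      (27 * n + 12) / 48 + (edgeExcess n (IsRooting.desc r par v).card : ℝ) / 48 := by
    intro v _
    have hle : (IsRooting.desc r par v).card ≤ n := Finset.card_le_univ _
    simp only [firstBound, edgeExcess]
    push_cast [Nat.cast_sub hle]
    ring
  rw [Finset.sum_congr rfl h4, Finset.sum_add_distrib, Finset.sum_const,
    Finset.card_erase_of_mem (mem_univ r), Finset.card_univ, ← hn, nsmul_eq_mul, Nat.cast_sub hn1, ← Finset.sum_div]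
  have h5 := (le_forestExcess hn1).trans h.forestExcess_le_sum
  rw [← hn] at h5
  have h6 : (12 : ℝ) + n * (firstExcess (n + 1) - 6) ≤
      ∑ v ∈ univ.erase r, (edgeExcess n (IsRooting.desc r par v).card : ℝ) := by
    exact_mod_cast h5
  simp only [firstBound]
  push_cast
  linarith

theorem SimpleGraph.ConnectedComponent.connected_induce_image_supp {V : Type*} {G : SimpleGraph V} {S : Set V}
    (c : (G.induce S).ConnectedComponent) : (G.induce (Subtype.val '' c.supp)).Connected := by
  have h := c.connected_toSimpleGraph
  let φ : c.toSimpleGraph →g G.induce (Subtype.val '' c.supp) :=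
    { toFun := fun x => ⟨x.1.1, x.1, x.2, rfl⟩
      map_rel' := fun hxy => hxy }
  refine h.map φ ?_
  rintro ⟨_, x, hx, rfl⟩
  exact ⟨⟨x, hx⟩, rfl⟩

/-- The lower bounds for both players, by simultaneous induction on the size of the subtree. -/
theorem firstBound_le_and_le {V : Type*} [Finite V] {G : SimpleGraph V} (hG : G.IsAcyclic)
    {P Q : Set V → ℝ}
    (hP : ∀ S : Set V, S.Nonempty → (G.induce S).Connected →
      P S = ⨆ v : S, (1 / (S.ncard : ℝ) + (1 / (S.ncard : ℝ)) *
        ∑ᶠ c : (G.induce (S \ {(v : V)})).ConnectedComponent,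
          ((Subtype.val '' c.supp).ncard : ℝ) * Q (Subtype.val '' c.supp)))
    (hQ : ∀ S : Set V, S.Nonempty → (G.induce S).Connected →
      Q S = (1 / (S.ncard : ℝ) ^ 2) *
        ∑ᶠ v : S, ∑ᶠ c : (G.induce (S \ {(v : V)})).ConnectedComponent,
          ((Subtype.val '' c.supp).ncard : ℝ) * P (Subtype.val '' c.supp))
    (S : Set V) (hS : S.Nonempty) (hconn : (G.induce S).Connected) :
    firstBound S.ncard ≤ S.ncard * P S ∧ firstBound (S.ncard + 1) - 1 ≤ S.ncard * Q S := by
  classical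
  induction hn : S.ncard using Nat.strong_induction_on generalizing S with
  | _ n ih =>
    have hn0 : 0 < n := hn ▸ (Set.ncard_pos).2 hS
    have hnR : (0 : ℝ) < n := by exact_mod_cast hn0
    have hcomp : ∀ (v : S) (c : (G.induce (S \ {(v : V)})).ConnectedComponent),
        (Subtype.val '' c.supp).ncard < n := by
      intro v c
      rw [← hn]
      refine Set.ncard_lt_ncard (ssubset_of_subset_of_ne ?_ fun h => ?_)
      · rintro _ ⟨x, -, rfl⟩
        exact x.2.1
      · obtain ⟨x, -, hx⟩ : (v : V) ∈ Subtype.val '' c.supp := by rw [h]; exact v.2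
        exact x.2.2 hx
    constructor
    · have hbdd : ∀ v : S, 1 + ∑ᶠ c : (G.induce (S \ {(v : V)})).ConnectedComponent,
          ((Subtype.val '' c.supp).ncard : ℝ) * Q (Subtype.val '' c.supp) ≤ n * P S := by
        intro v
        have := le_ciSup (f := fun v : S => (1 / (S.ncard : ℝ) + (1 / (S.ncard : ℝ)) *
          ∑ᶠ c : (G.induce (S \ {(v : V)})).ConnectedComponent,
          ((Subtype.val '' c.supp).ncard : ℝ) * Q (Subtype.val '' c.supp)))
          (Set.finite_range _).bddAbove v
        rw [← hP S hS hconn, hn, ← mul_one_add, one_div_mul_eq_div, div_le_iff₀' hnR] at this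
        exact this
      by_cases h1 : n = 1
      · obtain ⟨v, hv⟩ := Set.ncard_eq_one.1 (hn.trans h1)
        have := hbdd ⟨v, hv ▸ rfl⟩
        have hemp : IsEmpty ↥(S \ {v}) := by
          rw [hv, sdiff_self]
          exact Set.isEmpty_coe_sort.2 rfl
        have : IsEmpty (G.induce (S \ {v})).ConnectedComponent :=
          ⟨fun c => hemp.elim c.nonempty_supp.some⟩
        rw [finsum_of_isEmpty] at *
        subst h1
        norm_num [firstBound, firstExcess] at *
        linarith
      · have hnt : Nontrivial S := by
          rw [Set.nontrivial_coe_sort, ← Set.one_lt_ncard_iff_nontrivial]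
          omega
        obtain ⟨v, hv⟩ :=
          hconn.exists_connected_induce_compl_singleton_of_finite_nontrivial
        have hv' : (G.induce (S \ {(v : V)})).Connected := by
          let φ : (G.induce S).induce {v}ᶜ →g G.induce (S \ {(v : V)}) :=
            { toFun := fun x => ⟨x.1.1, x.1.2, fun h => x.2 (Subtype.ext h)⟩
              map_rel' := fun hxy => hxy }
          refine hv.map φ ?_
          rintro ⟨x, hx, hxv⟩
          exact ⟨⟨⟨x, hx⟩, fun h => hxv (congrArg Subtype.val h)⟩, rfl⟩
        have hcard : (S \ {(v : V)}).ncard + 1 = n := by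
          rw [Set.ncard_sdiff_singleton_add_one v.2, hn]
        have hne := hv'.nonempty
        have := hv'.preconnected.subsingleton_connectedComponent
        let c₀ := (G.induce (S \ {(v : V)})).connectedComponentMk hne.some
        have hsupp : Subtype.val '' c₀.supp = S \ {(v : V)} := by
          have : c₀.supp = Set.univ := Set.eq_univ_of_forall fun x => Subsingleton.elim _ _
          rw [this, Set.image_univ, Subtype.range_coe]
        have hQS := (ih _ (by omega) _ (Set.nonempty_coe_sort.1 hne) hv' rfl).2
        have hPS := hbdd v
        rw [finsum_eq_single _ c₀ fun c hc => (hc (Subsingleton.elim _ _)).elim, hsupp] at hPS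
        rw [hcard] at hQS
        linarith
    · have := Fintype.ofFinite S
      have hcardS : Fintype.card S = n := by
        rw [← hn, ← Nat.card_eq_fintype_card, Nat.card_coe_set_eq]
      have key := sum_component_lower_bound (H := G.induce S) ⟨hconn, hG.induce S⟩
        (fun v : S => ∑ᶠ c : (G.induce (S \ {(v : V)})).ConnectedComponent,
          ((Subtype.val '' c.supp).ncard : ℝ) * P (Subtype.val '' c.supp)) (by
        intro v
        refine ⟨↥(S \ {(v : V)}), inferInstance, G.induce (S \ {(v : V)}),
          ⟨⟨fun x => ⟨x.1, x.2.1⟩, fun x y hxy => ?_⟩, Iff.rfl⟩, fun w => ⟨fun hw => ?_, ?_⟩, ?_⟩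
        · exact Subtype.ext (congrArg (fun z : S => (z : V)) hxy)
        · exact ⟨⟨w.1, w.2, fun h => hw (Subtype.ext h)⟩, rfl⟩
        · rintro ⟨b, rfl⟩ h
          exact b.2.2 (congrArg Subtype.val h)
        · have : Fintype (G.induce (S \ {(v : V)})).ConnectedComponent := Fintype.ofFinite _
          rw [finsum_eq_sum_of_fintype, finsum_eq_sum_of_fintype]
          refine Finset.sum_le_sum fun c _ => ?_
          rw [← Set.ncard_image_of_injective c.supp Subtype.val_injective]
          exact (ih _ (hcomp v c) _ (c.nonempty_supp.image _)
            (SimpleGraph.ConnectedComponent.connected_induce_image_supp c) rfl).1)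
      rw [hcardS, ← finsum_eq_sum_of_fintype] at key
      rw [hQ S hS hconn, hn, ← mul_assoc, show (n : ℝ) * (1 / (n : ℝ) ^ 2) = 1 / n by field_simp,
        one_div_mul_eq_div, le_div_iff₀' hnR]
      exact key


theorem stmt_16 {V : Type*} [Fintype V] (G : SimpleGraph V) (hG : G.IsTree)
    (hn : 4 ≤ Fintype.card V)
    (P Q : Set V → ℝ)
    (hP : ∀ S : Set V, S.Nonempty → (G.induce S).Connected →
      P S = ⨆ v : S, (1 / (S.ncard : ℝ) + (1 / (S.ncard : ℝ)) *
        ∑ᶠ c : (G.induce (S \ {(v : V)})).ConnectedComponent,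
          ((Subtype.val '' c.supp).ncard : ℝ) * Q (Subtype.val '' c.supp)))
    (hQ : ∀ S : Set V, S.Nonempty → (G.induce S).Connected →
      Q S = (1 / (S.ncard : ℝ) ^ 2) *
        ∑ᶠ v : S, ∑ᶠ c : (G.induce (S \ {(v : V)})).ConnectedComponent,
          ((Subtype.val '' c.supp).ncard : ℝ) * P (Subtype.val '' c.supp)) :
    9 / 16 < P Set.univ ∧
      9 / 16 - 5 / (16 * (Fintype.card V : ℝ)) ≤ Q Set.univ := by
  have hc := hG.connected
  have huniv : (G.induce Set.univ).Connected := (SimpleGraph.induceUnivIso G).connected_iff.2 hc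
  have hne : (Set.univ : Set V).Nonempty := Set.nonempty_iff_univ_nonempty.1 hc.nonempty
  obtain ⟨h1, h2⟩ := firstBound_le_and_le hG.isAcyclic hP hQ Set.univ hne huniv
  rw [Set.ncard_univ, Nat.card_eq_fintype_card] at h1 h2
  set n := Fintype.card V
  have hnR : (0 : ℝ) < n := by exact_mod_cast (lt_of_lt_of_le (by norm_num) hn : 0 < n)
  have h3 : (0 : ℝ) < firstExcess n := by
    exact_mod_cast firstExcess_pos (le_trans (by norm_num) hn)
  have h4 : (6 : ℝ) ≤ firstExcess (n + 1) := by
    exact_mod_cast six_le_firstExcess (Nat.succ_le_succ hn)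
  simp only [firstBound] at h1 h2
  push_cast at h2
  constructor
  · refine lt_of_mul_lt_mul_left ?_ hnR.le
    linarith
  · refine le_of_mul_le_mul_left ?_ hnR
    have : (n : ℝ) * (9 / 16 - 5 / (16 * n)) = 9 * n / 16 - 5 / 16 := by field_simp
    linarith
end

section
/- Let a : ℕ → ℝ satisfy a_1 = 1 and, for every integer n ≥ 2, a_n = 1 − 1/n + 1/n² − ((n−1)/n)²·a_{n−1}. Then for every positive integer n, a_n = 1/2 + 1/(2n²) if n is odd and a_n = 1/2 if n is even. -/
theorem stmt_17 (a : ℕ → ℝ) (ha1 : a 1 = 1)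
    (ha : ∀ n : ℕ, 2 ≤ n →
      a n = 1 - 1 / (n : ℝ) + 1 / (n : ℝ) ^ 2 - (((n : ℝ) - 1) / (n : ℝ)) ^ 2 * a (n - 1)) :
    ∀ n : ℕ, 1 ≤ n →
      a n = if Odd n then 1 / 2 + 1 / (2 * (n : ℝ) ^ 2) else 1 / 2 := by
  intro n hn
  induction n, hn using Nat.le_induction with
  | base => norm_num [ha1]
  | succ n hn ih =>
    have hn0 : (n : ℝ) ≠ 0 := by positivity
    have hn1 : (n : ℝ) + 1 ≠ 0 := by positivity
    rw [ha (n + 1) (by omega), Nat.add_sub_cancel, ih]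
    by_cases hodd : Odd n
    · rw [if_pos hodd, if_neg (Nat.not_odd_iff_even.mpr hodd.add_one)]
      push_cast
      rw [add_sub_cancel_right]
      field_simp
      ring
    · rw [if_neg hodd, if_pos (Nat.not_odd_iff_even.mp hodd).add_one]
      push_cast
      rw [add_sub_cancel_right]
      field_simp
      ring
end

section
/- Let a : ℕ → ℝ satisfy a_0 = 1/2 and, for every integer n ≥ 1, a_n = 1 − (1/n²)·Σ_{k=1}^{n} [(k−1)·a_{k−1} + (n−k)·a_{n−k}]. Then for every integer n ≥ 3, a_n = 1/2 + 1/(6n). -/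
/-- Both halves of the sum run over the same values `j * a j` with `j < n`. -/
theorem sum_Icc_pred_add_sub (a : ℕ → ℝ) (n : ℕ) :
    ∑ k ∈ Finset.Icc 1 n,
        (((k : ℝ) - 1) * a (k - 1) + ((n : ℝ) - (k : ℝ)) * a (n - k)) =
      2 * ∑ j ∈ Finset.range n, (j : ℝ) * a j := by
  have key : ∀ f : ℕ → ℝ, ∑ k ∈ Finset.Icc 1 n, f k = ∑ j ∈ Finset.range n, f (j + 1) := by
    intro f
    rw [Finset.range_eq_Ico, Finset.sum_Ico_add' f 0 n 1]
    rfl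
  rw [key, Finset.sum_add_distrib, two_mul]
  congr 1
  · refine Finset.sum_congr rfl fun j _ => ?_
    simp
  · rw [← Finset.sum_range_reflect (fun j : ℕ => (j : ℝ) * a j) n]
    refine Finset.sum_congr rfl fun j hj => ?_
    have hj' : j + 1 ≤ n := Finset.mem_range.mp hj
    rw [show n - 1 - j = n - (j + 1) by omega, Nat.cast_sub hj']

theorem stmt_18 (a : ℕ → ℝ) (ha0 : a 0 = 1 / 2)
    (ha : ∀ n : ℕ, 1 ≤ n →
      a n = 1 - (1 / (n : ℝ) ^ 2) * ∑ k ∈ Finset.Icc 1 n,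
        (((k : ℝ) - 1) * a (k - 1) + ((n : ℝ) - (k : ℝ)) * a (n - k))) :
    ∀ n : ℕ, 3 ≤ n → a n = 1 / 2 + 1 / (6 * (n : ℝ)) := by
  simp only [sum_Icc_pred_add_sub] at ha
  have of_sum : ∀ n : ℕ, 3 ≤ n →
      ∑ j ∈ Finset.range n, (j : ℝ) * a j = (n : ℝ) ^ 2 / 4 - n / 12 →
      a n = 1 / 2 + 1 / (6 * (n : ℝ)) := by
    intro n hn hS
    have hn0 : (n : ℝ) ≠ 0 := by
      have : n ≠ 0 := by omega
      exact_mod_cast this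
    rw [ha n (by omega), hS]
    field_simp
    ring
  have sum_eq : ∀ n : ℕ, 3 ≤ n →
      ∑ j ∈ Finset.range n, (j : ℝ) * a j = (n : ℝ) ^ 2 / 4 - n / 12 := by
    intro n hn
    induction n, hn using Nat.le_induction with
    | base =>
      have h1 : a 1 = 1 := by simpa using ha 1 le_rfl
      have h2 : a 2 = 1 / 2 := by
        rw [ha 2 (by norm_num)]
        norm_num [Finset.sum_range_succ, h1]
      norm_num [Finset.sum_range_succ, h1, h2]
    | succ n hn ih =>
      have hn0 : (n : ℝ) ≠ 0 := by
        have : n ≠ 0 := by omega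
        exact_mod_cast this
      rw [Finset.sum_range_succ, ih, of_sum n hn ih]
      push_cast
      field_simp
      ring
  exact fun n hn => of_sum n hn (sum_eq n hn)
end
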